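/- arXiv:math/0503649 — 4 statements merged into one kernel-verified Lean document; each statement's English description precedes it below -/
import Mathlib

section
/- For all real constants c > 0, K > 0 and every integer k ≥ 3 there exists a threshold n₀ = n₀(c, K, k) such that the following holds. Let A be a finite set of real numbers with |A| = n ≥ n₀, and let G be a graph with vertex set A such that G has at least c·n² edges and the sumset of A along G satisfies |A +_G A| ≤ K·|A|. Then A contains a k-term arithmetic progression, i.e., there exist a real number x and a nonzero real number d such that x + i·d ∈ A for every integer i with 0 ≤ i ≤ k−1. -/
namespace DHJ
open Combinatorics

/-! ### averages over finite types -/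

noncomputable def avg {X : Type} (f : X → ℝ) : ℝ := (∑ᶠ x, f x) / Nat.card X

noncomputable def D {X : Type} (S : Set X) : ℝ := avg (S.indicator (fun _ => (1:ℝ)))

section avg
variable {X Y : Type} [Finite X] [Finite Y]

lemma avg_eq [Fintype X] (f : X → ℝ) : avg f = (∑ x, f x) / Fintype.card X := by
  simp [avg, finsum_eq_sum_of_fintype]

lemma avg_add (f g : X → ℝ) : avg (fun x => f x + g x) = avg f + avg g := by
  have := Fintype.ofFinite X
  simp only [avg_eq, Finset.sum_add_distrib, add_div]

lemma avg_sub (f g : X → ℝ) : avg (fun x => f x - g x) = avg f - avg g := by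
  have := Fintype.ofFinite X
  simp only [avg_eq, Finset.sum_sub_distrib, sub_div]

lemma avg_mul_left (c : ℝ) (f : X → ℝ) : avg (fun x => c * f x) = c * avg f := by
  have := Fintype.ofFinite X
  simp only [avg_eq, ← Finset.mul_sum, mul_div_assoc]

lemma avg_const [Nonempty X] (c : ℝ) : avg (fun _ : X => c) = c := by
  have := Fintype.ofFinite X
  have h : (Fintype.card X : ℝ) ≠ 0 := by exact_mod_cast Fintype.card_ne_zero
  simp only [avg_eq, Finset.sum_const, Finset.card_univ, nsmul_eq_mul]
  field_simp

lemma avg_mono {f g : X → ℝ} (h : ∀ x, f x ≤ g x) : avg f ≤ avg g := by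
  have := Fintype.ofFinite X
  simp only [avg_eq]
  gcongr
  exact h _

lemma avg_nonneg {f : X → ℝ} (h : ∀ x, 0 ≤ f x) : 0 ≤ avg f := by
  have := Fintype.ofFinite X
  simp only [avg_eq]
  have := Finset.sum_nonneg (s := Finset.univ) (fun x _ => h x)
  positivity

lemma avg_le [Nonempty X] {f : X → ℝ} {c : ℝ} (h : ∀ x, f x ≤ c) : avg f ≤ c :=
  (avg_mono h).trans_eq (avg_const c)

lemma le_avg [Nonempty X] {f : X → ℝ} {c : ℝ} (h : ∀ x, c ≤ f x) : c ≤ avg f :=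
  (avg_const c).symm.trans_le (avg_mono h)

lemma exists_avg_le [Nonempty X] (f : X → ℝ) : ∃ x, avg f ≤ f x := by
  by_contra! h
  have := Fintype.ofFinite X
  obtain ⟨x, hx⟩ := Finite.exists_max f
  exact absurd (avg_le hx) (not_le.2 (h x))

lemma avg_equiv (e : X ≃ Y) (f : Y → ℝ) : avg (fun x => f (e x)) = avg f := by
  have := Fintype.ofFinite X
  have := Fintype.ofFinite Y
  simp only [avg_eq, Fintype.card_congr e]
  congr 1
  exact Equiv.sum_comp e f

lemma avg_prod (f : X → Y → ℝ) : avg (fun p : X × Y => f p.1 p.2) = avg fun x => avg (f x) := by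
  have := Fintype.ofFinite X
  have := Fintype.ofFinite Y
  simp only [avg_eq, Fintype.card_prod, Fintype.sum_prod_type, Nat.cast_mul, ← Finset.sum_div]
  rw [div_div, mul_comm]

lemma avg_comm (f : X → Y → ℝ) : (avg fun x => avg (f x)) = avg fun y => avg fun x => f x y := by
  have := Fintype.ofFinite X
  have := Fintype.ofFinite Y
  simp only [avg_eq, ← Finset.sum_div]
  rw [Finset.sum_comm, div_div, div_div, mul_comm]

lemma avg_sum {C : Type} [Fintype C] (f : C → X → ℝ) :
    avg (fun x => ∑ c, f c x) = ∑ c, avg (f c) := by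
  have := Fintype.ofFinite X
  simp only [avg_eq, ← Finset.sum_div]
  rw [Finset.sum_comm]

lemma D_nonneg (S : Set X) : 0 ≤ D S :=
  avg_nonneg fun x => Set.indicator_nonneg (fun _ _ => zero_le_one) x

lemma D_mono {S T : Set X} (h : S ⊆ T) : D S ≤ D T :=
  avg_mono fun x => Set.indicator_le_indicator_of_subset h (fun _ => zero_le_one) x

lemma ind_le_one (S : Set X) (x : X) : S.indicator (fun _ => (1:ℝ)) x ≤ 1 := by
  classical
  rw [Set.indicator_apply]; split_ifs <;> norm_num

lemma D_le_one [Nonempty X] (S : Set X) : D S ≤ 1 := avg_le (ind_le_one S)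

lemma D_univ [Nonempty X] : D (Set.univ : Set X) = 1 := by
  simp [D, avg_const]

lemma D_empty : D (∅ : Set X) = 0 := by
  have := Fintype.ofFinite X
  simp [D, avg_eq]

lemma D_nonempty {S : Set X} (h : 0 < D S) : S.Nonempty := by
  rw [Set.nonempty_iff_ne_empty]
  rintro rfl
  simp [D_empty] at h

lemma D_pos [Nonempty X] {S : Set X} {x : X} (h : x ∈ S) : (1:ℝ) / Nat.card X ≤ D S := by
  have := Fintype.ofFinite X
  classical
  rw [D, avg_eq, Nat.card_eq_fintype_card]
  gcongr
  calc (1:ℝ) = S.indicator (fun _ => (1:ℝ)) x := by simp [h]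
    _ ≤ _ := Finset.single_le_sum (f := S.indicator (fun _ => (1:ℝ)))
      (fun x _ => Set.indicator_nonneg (fun _ _ => zero_le_one) x) (Finset.mem_univ x)

lemma D_compl [Nonempty X] (S : Set X) : D Sᶜ = 1 - D S := by
  have : D S + D Sᶜ = 1 := by
    rw [D, D, ← avg_add, ← avg_const (X := X) 1]
    congr 1; ext x
    by_cases h : x ∈ S <;> simp [h, avg_const]
  linarith

lemma D_union_le (S T : Set X) : D (S ∪ T) ≤ D S + D T := by
  rw [D, D, D, ← avg_add]
  apply avg_mono
  intro x
  by_cases h : x ∈ S <;> by_cases h' : x ∈ T <;> simp [h, h']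

lemma D_inter_add_diff (S T : Set X) : D (S ∩ T) + D (S \ T) = D S := by
  rw [D, D, D, ← avg_add]
  congr 1; ext x
  by_cases h : x ∈ S <;> by_cases h' : x ∈ T <;> simp [h, h']

lemma D_equiv (e : X ≃ Y) (S : Set Y) : D (e ⁻¹' S) = D S := by
  rw [D, D, ← avg_equiv e]
  rfl

/-- Markov -/
lemma markov [Nonempty X] {f : X → ℝ} (hf : ∀ x, f x ≤ 1) {δ : ℝ} (hδ : 0 < δ)
    (h : δ ≤ avg f) : δ / 2 ≤ D {x | δ / 2 ≤ f x} := by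
  have h1 : avg f ≤ D {x | δ / 2 ≤ f x} + δ / 2 := by
    rw [D, ← avg_const (X := X) (δ/2), ← avg_add]
    apply avg_mono
    intro x
    by_cases hx : δ / 2 ≤ f x
    · rw [avg_const, Set.indicator_of_mem (by exact hx)]; linarith [hf x]
    · rw [avg_const, Set.indicator_of_notMem (by exact hx)]; linarith
  linarith

lemma D_le_sum {C : Type} [Fintype C] (T : Set X) (S : C → Set X)
    (h : ∀ t ∈ T, ∃ c, t ∈ S c) : D T ≤ ∑ c, D (S c) := by
  simp only [D]
  rw [← avg_sum]
  apply avg_mono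
  intro x
  by_cases hx : x ∈ T
  · obtain ⟨c, hc⟩ := h x hx
    rw [Set.indicator_of_mem hx]
    calc (1:ℝ) = (S c).indicator (fun _ => (1:ℝ)) x := by simp [hc]
      _ ≤ _ := Finset.single_le_sum (f := fun c => (S c).indicator (fun _ => (1:ℝ)) x)
        (fun c _ => Set.indicator_nonneg (fun _ _ => zero_le_one) x) (Finset.mem_univ c)
  · rw [Set.indicator_of_notMem hx]
    exact Finset.sum_nonneg fun c _ => Set.indicator_nonneg (fun _ _ => zero_le_one) x

lemma pigeon {C : Type} [Finite C] [Nonempty C] (T : Set X) (S : C → Set X)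
    (h : ∀ t ∈ T, ∃ c, t ∈ S c) : ∃ c, D T / Nat.card C ≤ D (S c) := by
  have := Fintype.ofFinite C
  have h1 := D_le_sum T S h
  obtain ⟨c, hc⟩ := exists_avg_le (fun c => D (S c))
  refine ⟨c, le_trans ?_ hc⟩
  rw [avg_eq, Nat.card_eq_fintype_card]
  gcongr

lemma D_avg_comm (S : X → Set Y) : (avg fun x => D (S x)) = avg fun y => D {x | y ∈ S x} := by
  simp only [D]
  rw [avg_comm]; rfl

variable {ι κ α : Type} [Finite ι] [Finite κ] [Finite α]

lemma avg_sumElim (f : (ι ⊕ κ → α) → ℝ) :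
    avg f = avg fun x : ι → α => avg fun y : κ → α => f (Sum.elim x y) := by
  rw [← avg_prod (fun (x : ι → α) (y : κ → α) => f (Sum.elim x y))]
  rw [← avg_equiv (Equiv.sumArrowEquivProdArrow ι κ α).symm]
  rfl

lemma avg_sumElim' (f : (ι ⊕ κ → α) → ℝ) :
    avg f = avg fun y : κ → α => avg fun x : ι → α => f (Sum.elim x y) := by
  rw [avg_sumElim, avg_comm]

lemma D_sumElim (S : Set (ι ⊕ κ → α)) :
    D S = avg fun x : ι → α => D {y : κ → α | Sum.elim x y ∈ S} := by
  rw [D, avg_sumElim]; rfl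

lemma D_sumElim' (S : Set (ι ⊕ κ → α)) :
    D S = avg fun y : κ → α => D {x : ι → α | Sum.elim x y ∈ S} := by
  rw [D, avg_sumElim']; rfl

lemma D_pi (U : ι → Set α) [Fintype ι] : D {x : ι → α | ∀ i, x i ∈ U i} = ∏ i, D (U i) := by
  classical
  have := Fintype.ofFinite α
  simp only [D, avg_eq]
  rw [Finset.prod_div_distrib, Finset.prod_univ_sum]
  congr 1
  · rw [Fintype.piFinset_univ]
    apply Finset.sum_congr rfl
    intro x _
    by_cases h : ∀ i, x i ∈ U i
    · rw [Set.indicator_of_mem (by exact h)]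
      rw [Finset.prod_eq_one]
      intro i _
      simp [h i]
    · rw [Set.indicator_of_notMem (by exact h)]
      push Not at h
      obtain ⟨i, hi⟩ := h
      rw [Finset.prod_eq_zero (Finset.mem_univ i)]
      simp [hi]
  · simp

end avg
end DHJ

namespace DHJ
open Combinatorics

section sub
variable {α β ι κ η ζ : Type}

def comp (l : Subspace η α ι) (m : Subspace ζ α η) : Subspace ζ α ι where
  idxFun i := (l.idxFun i).elim Sum.inl m.idxFun
  proper e := by
    obtain ⟨j, hj⟩ := m.proper e
    obtain ⟨i, hi⟩ := l.proper j
    exact ⟨i, by simp [hi, hj]⟩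

lemma comp_apply (l : Subspace η α ι) (m : Subspace ζ α η) (x : ζ → α) :
    comp l m x = l (m x) := by
  ext i
  simp only [Subspace.coe_apply, comp]
  rcases l.idxFun i with a | j <;> simp [Subspace.coe_apply]

/-- Extend a subspace over `β` to a subspace over `Option β`. -/
def opt (l : Subspace η β ι) : Subspace η (Option β) ι where
  idxFun i := (l.idxFun i).map some id
  proper e := by
    obtain ⟨i, hi⟩ := l.proper e
    exact ⟨i, by simp [hi]⟩

lemma opt_apply (l : Subspace η β ι) (x : η → Option β) (i : ι) :
    opt l x i = (l.idxFun i).elim some x := by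
  simp only [Subspace.coe_apply, opt]
  rcases l.idxFun i with a | j <;> simp

lemma opt_some (l : Subspace η β ι) (x : η → β) :
    opt l (fun e => some (x e)) = fun i => some (l x i) := by
  ext1 i
  rw [opt_apply, Subspace.coe_apply]
  rcases l.idxFun i with a | j <;> simp

lemma opt_getD (l : Subspace η β ι) (x : η → Option β) (b : β) (i : ι) :
    (opt l x i).getD b = l (fun e => (x e).getD b) i := by
  rw [opt_apply, Subspace.coe_apply]
  rcases l.idxFun i with a | j <;> simp

lemma opt_comp (l : Subspace η β ι) (m : Subspace ζ β η) (x : ζ → Option β) :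
    opt (comp l m) x = opt l (opt m x) := by
  ext1 i
  simp only [opt_apply, comp]
  rcases l.idxFun i with a | j <;> simp [opt_apply]

/-- subspace times point -/
def horiz (l : Subspace η α ι) (v : κ → α) : Subspace η α (ι ⊕ κ) where
  idxFun := Sum.elim l.idxFun (fun j => Sum.inl (v j))
  proper e := by
    obtain ⟨i, hi⟩ := l.proper e
    exact ⟨Sum.inl i, by simp [hi]⟩

lemma horiz_apply (l : Subspace η α ι) (v : κ → α) (x : η → α) :
    horiz l v x = Sum.elim (l x) v := by
  ext i
  rcases i with i | i <;> simp [Subspace.coe_apply, horiz]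

def vert (v : ι → α) (l : Subspace η α κ) : Subspace η α (ι ⊕ κ) where
  idxFun := Sum.elim (fun j => Sum.inl (v j)) l.idxFun
  proper e := by
    obtain ⟨i, hi⟩ := l.proper e
    exact ⟨Sum.inr i, by simp [hi]⟩

lemma vert_apply (v : ι → α) (l : Subspace η α κ) (x : η → α) :
    vert v l x = Sum.elim v (l x) := by
  ext i
  rcases i with i | i <;> simp [Subspace.coe_apply, vert]

/-- line times subspace -/
def prodOpt (l : Subspace Unit α ι) (m : Subspace η α κ) : Subspace (Option η) α (ι ⊕ κ) where
  idxFun := Sum.elim (fun i => (l.idxFun i).map id (fun _ => none))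
    (fun i => (m.idxFun i).map id some)
  proper e := by
    cases e with
    | none =>
      obtain ⟨i, hi⟩ := l.proper ()
      exact ⟨Sum.inl i, by simp [hi]⟩
    | some e =>
      obtain ⟨i, hi⟩ := m.proper e
      exact ⟨Sum.inr i, by simp [hi]⟩

lemma prodOpt_apply (l : Subspace Unit α ι) (m : Subspace η α κ) (x : Option η → α) :
    prodOpt l m x = Sum.elim (l (fun _ => x none)) (m (fun e => x (some e))) := by
  ext i
  rcases i with i | i
  · simp only [Subspace.coe_apply, prodOpt, Sum.elim_inl]
    rcases l.idxFun i with a | a <;> simp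
  · simp only [Subspace.coe_apply, prodOpt, Sum.elim_inr]
    rcases m.idxFun i with a | a <;> simp

lemma opt_prodOpt (l : Subspace Unit β ι) (m : Subspace η β κ) (x : Option η → Option β) :
    opt (prodOpt l m) x = Sum.elim (opt l (fun _ => x none)) (opt m (fun e => x (some e))) := by
  ext1 i
  rw [opt_apply]
  rcases i with i | i
  · simp only [prodOpt, Sum.elim_inl, opt_apply]
    rcases l.idxFun i with a | a <;> simp
  · simp only [prodOpt, Sum.elim_inr, opt_apply]
    rcases m.idxFun i with a | a <;> simp

instance [Finite α] [Finite ι] [Finite η] : Finite (Subspace η α ι) :=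
  Finite.of_injective (fun l => l.idxFun) fun l m h => by
    ext1; exact h

lemma sub_injective (l : Subspace η α ι) : Function.Injective (fun x : η → α => l x) := by
  intro x y h
  ext e
  obtain ⟨i, hi⟩ := l.proper e
  have := congrFun h i
  simpa [Subspace.coe_apply, hi] using this

end sub

/-- every set of density at least `δ` in `ι → β` contains an `η`-dimensional subspace -/
def MGood (β η ι : Type) (δ : ℝ) : Prop :=
  ∀ A : Set (ι → β), δ ≤ D A → ∃ V : Subspace η β ι, ∀ x, V x ∈ A

def DHJP (β : Type) : Prop := ∀ δ : ℝ, 0 < δ → ∃ (ι : Type) (_ : Finite ι), MGood β Unit ι δ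

section good
variable {β η ι κ : Type} [Finite β] [Nonempty β] [Finite ι] [Finite κ] [Finite η]

lemma MGood.sum {δ : ℝ} (h : MGood β η ι δ) : MGood β η (ι ⊕ κ) δ := by
  intro A hA
  rw [D_sumElim'] at hA
  obtain ⟨y, hy⟩ := exists_avg_le (fun y : κ → β => D {x : ι → β | Sum.elim x y ∈ A})
  obtain ⟨V, hV⟩ := h _ (hA.trans hy)
  exact ⟨horiz V y, fun x => by rw [horiz_apply]; exact hV x⟩

lemma MGood.equiv {δ : ℝ} (h : MGood β η ι δ) (e : ι ≃ κ) : MGood β η κ δ := by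
  intro A hA
  rw [← D_equiv (e.arrowCongr (Equiv.refl β))] at hA
  obtain ⟨V, hV⟩ := h _ hA
  refine ⟨V.reindex (Equiv.refl _) (Equiv.refl _) e, fun x => ?_⟩
  have h2 : V.reindex (Equiv.refl _) (Equiv.refl _) e x
      = (e.arrowCongr (Equiv.refl β)) (V x) := by
    ext i
    simp [Equiv.arrowCongr]
  rw [h2]
  exact hV x

lemma MGood.card {δ : ℝ} (h : MGood β η ι δ) (hc : Nat.card ι ≤ Nat.card κ) : MGood β η κ δ := by
  have h1 := h.sum (κ := Fin (Nat.card κ - Nat.card ι))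
  apply h1.equiv
  apply Classical.choice
  rw [← Cardinal.eq, ← Nat.cast_card, ← Nat.cast_card (α := κ), Nat.card_sum]
  congr 1
  simp; omega

lemma MGood.mono {δ δ' : ℝ} (h : MGood β η ι δ) (hc : δ ≤ δ') : MGood β η ι δ' :=
  fun A hA => h A (hc.trans hA)

end good

lemma MDHJ {β : Type} [Finite β] [Nonempty β] (h : DHJP β) (η : Type) [Finite η] :
    ∀ δ : ℝ, 0 < δ → ∃ (ι : Type) (_ : Finite ι), MGood β η ι δ := by
  revert η
  intro η hη
  refine Finite.induction_empty_option
    (P := fun η => ∀ δ : ℝ, 0 < δ → ∃ (ι : Type) (_ : Finite ι), MGood β η ι δ) ?_ ?_ ?_ η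
  · intro η η' e ih δ hδ
    obtain ⟨ι, hι, hh⟩ := ih δ hδ
    refine ⟨ι, hι, fun A hA => ?_⟩
    obtain ⟨V, hV⟩ := hh A hA
    refine ⟨V.reindex e (Equiv.refl _) (Equiv.refl _), fun x => ?_⟩
    have h2 : V.reindex e (Equiv.refl _) (Equiv.refl _) x = V (x ∘ e) := by
      ext i
      simp
    rw [h2]
    exact hV _
  · intro δ hδ
    refine ⟨PEmpty, inferInstance, fun A hA => ?_⟩
    obtain ⟨x, hx⟩ := D_nonempty (hδ.trans_le hA)
    exact ⟨⟨fun i => i.elim, fun i => i.elim⟩, fun y => by convert hx; exact Subsingleton.elim _ _⟩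
  · intro η _ ih δ hδ
    have := Fintype.ofFinite η
    obtain ⟨ι, hι, h1⟩ := h (δ / 2) (by positivity)
    by_cases hne : Nonempty (Subspace Unit β ι)
    swap
    · refine ⟨ι, hι, fun A hA => ?_⟩
      obtain ⟨V, hV⟩ := h1 A (by linarith)
      exact absurd ⟨V⟩ hne
    have hc : 0 < Nat.card (Subspace Unit β ι) := Nat.card_pos
    obtain ⟨κ, hκ, h2⟩ := ih (δ / 2 / Nat.card (Subspace Unit β ι)) (by positivity)
    refine ⟨ι ⊕ κ, inferInstance, fun A hA => ?_⟩
    rw [D_sumElim'] at hA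
    have hm := markov (fun y => D_le_one _) hδ hA
    obtain ⟨L, hL⟩ := pigeon {y : κ → β | δ / 2 ≤ D {x : ι → β | Sum.elim x y ∈ A}} (fun L : Subspace Unit β ι =>
      {y : κ → β | ∀ x, Sum.elim (L x) y ∈ A}) (fun t ht => h1 _ ht)
    obtain ⟨V, hV⟩ := h2 _ (le_trans (by gcongr) hL)
    exact ⟨prodOpt L V, fun x => by rw [prodOpt_apply]; exact hV _ _⟩

end DHJ

namespace DHJ
open Combinatorics

def Ins {β ι : Type} (b : β) (S : Set (ι → Option β)) : Prop :=
  ∀ x y, (∀ i, (x i).getD b = (y i).getD b) → x ∈ S → y ∈ S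

section cover
variable {β η ι : Type} [Finite β] [Nonempty β] [Finite η]

lemma exists_op (β : Type) [Finite β] [Nonempty β] : ∃ op : β → β → β,
    (∀ c, Function.Injective (fun a => op a c)) ∧ ∀ a, Function.Bijective (op a) := by
  have e := Finite.equivFin β
  have : NeZero (Nat.card β) := ⟨Nat.card_pos.ne'⟩
  have h2 : ∀ a, Function.Injective (fun c => e.symm (e a + e c)) := by
    intro a c c' h
    simpa using h
  refine ⟨fun a c => e.symm (e a + e c), fun c a a' h => by simpa using h, fun a => ?_⟩
  exact ⟨h2 a, Finite.surjective_of_injective (h2 a)⟩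

lemma D_none_le : D ({none} : Set (Option β)) ≤ 1 / 2 := by
  have := Fintype.ofFinite β
  classical
  rw [D, avg_eq]
  have h : (∑ x : Option β, ({none} : Set (Option β)).indicator (fun _ => (1:ℝ)) x) = 1 := by
    simp
  rw [h]
  have : 0 < Fintype.card β := Fintype.card_pos
  have h2 : (2:ℝ) ≤ Fintype.card (Option β) := by
    rw [Fintype.card_option]; exact_mod_cast (by omega)
  gcongr

lemma D_bad_le {ι : Type} [Finite ι] (n : ℕ) :
    D {x : ι × Fin n → Option β | ∃ i, ∀ l, x (i, l) = none} ≤ Nat.card ι * (1 / 2) ^ n := by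
  classical
  have := Fintype.ofFinite ι
  refine (D_le_sum _ (fun i => {x : ι × Fin n → Option β | ∀ l, x (i, l) = none})
    (fun x hx => hx)).trans ?_
  have : ∀ i : ι, D {x : ι × Fin n → Option β | ∀ l, x (i, l) = none} ≤ (1 / 2) ^ n := by
    intro i
    have h1 : {x : ι × Fin n → Option β | ∀ l, x (i, l) = none} =
        {x | ∀ p, x p ∈ (if p.1 = i then {none} else Set.univ : Set (Option β))} := by
      ext x
      simp only [Set.mem_ofPred_eq]
      constructor
      · rintro h ⟨j, l⟩
        by_cases hj : j = i
        · subst hj; simp [h l]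
        · simp [hj]
      · intro h l
        simpa using h (i, l)
    rw [h1, D_pi, Fintype.prod_prod_type]
    rw [Finset.prod_eq_single i]
    · simp only [if_true, Finset.prod_const, Finset.card_univ, Fintype.card_fin]
      exact pow_le_pow_left₀ (D_nonneg _) D_none_le n
    · intro j _ hj
      simp [hj, D_univ]
    · simp
  refine (Finset.sum_le_sum fun i _ => this i).trans ?_
  simp

lemma block (hM : ∀ δ : ℝ, 0 < δ → ∃ (ι : Type) (_ : Finite ι), MGood β η ι δ) (b : β)
    {ε : ℝ} (hε : 0 < ε) : ∃ (ι : Type) (_ : Finite ι), ∀ S : Set (ι → Option β), Ins b S →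
      ε ≤ D S → ∃ V : Subspace η (Option β) ι, ∀ x, V x ∈ S := by
  classical
  obtain ⟨ι, hι, hG⟩ := hM (ε / 2) (by positivity)
  obtain ⟨n, hn0, hn⟩ : ∃ n : ℕ, 0 < n ∧ (Nat.card ι : ℝ) * (1 / 2) ^ n ≤ ε / 4 := by
    obtain ⟨n, hn⟩ := exists_pow_lt_of_lt_one (show (0:ℝ) < ε / 4 / (Nat.card ι + 1) by positivity)
      (show (1 / 2 : ℝ) < 1 by norm_num)
    refine ⟨n + 1, by omega, ?_⟩
    rw [lt_div_iff₀ (by positivity)] at hn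
    have : (0:ℝ) < (1/2)^n := by positivity
    rw [pow_succ]
    nlinarith [Nat.cast_nonneg (α := ℝ) (Nat.card ι)]
  refine ⟨ι × Fin n, inferInstance, fun S hS hD => ?_⟩
  obtain ⟨op, hop1, hop2⟩ := exists_op β
  let pat : (ι × Fin n → Option β) → Set (ι × Fin n) := fun x => {p | x p ≠ none}
  let J : Set (ι × Fin n) → ι → Fin n := fun P i =>
    if h : ∃ l, (i, l) ∈ P then h.choose else ⟨0, hn0⟩
  have hJ : ∀ P i, (∃ l, (i, l) ∈ P) → (i, J P i) ∈ P := by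
    intro P i h
    simp only [J, dif_pos h]
    exact h.choose_spec
  let Ψ : (ι × Fin n → Option β) → (ι → β) → (ι × Fin n → Option β) := fun x w p =>
    if p.2 = J (pat x) p.1 then (x p).map (fun a => op a (w p.1)) else x p
  have hpat : ∀ x w, pat (Ψ x w) = pat x := by
    intro x w
    ext p
    simp only [pat, Ψ, Set.mem_ofPred_eq]
    split_ifs <;> simp
  have hinj : ∀ w, Function.Injective (fun x => Ψ x w) := by
    intro w x x' h
    have hp : pat x = pat x' := by
      rw [← hpat x w, ← hpat x' w]; exact congrArg pat h
    ext1 p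
    have h1 := congrFun h p
    simp only [Ψ, hp] at h1
    split_ifs at h1
    · exact Option.map_injective (hop1 (w p.1)) h1
    · exact h1
  have hDS : D S = avg fun x => D {w | Ψ x w ∈ S} := by
    rw [D_avg_comm]
    have : ∀ w, D {x | Ψ x w ∈ S} = D S := by
      intro w
      exact D_equiv (Equiv.ofBijective _ ⟨hinj w, Finite.surjective_of_injective (hinj w)⟩) S
    simp only [Set.mem_ofPred_eq, this]
    rw [avg_const]
  obtain ⟨x, hx, hxD⟩ : ∃ x : ι × Fin n → Option β, (∀ i, ∃ l, x (i, l) ≠ none) ∧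
      ε / 2 ≤ D {w | Ψ x w ∈ S} := by
    by_contra! hcon
    have h1 : (avg fun x => D {w | Ψ x w ∈ S}) ≤
        D {x : ι × Fin n → Option β | ∃ i, ∀ l, x (i, l) = none} + ε / 2 := by
      rw [D.eq_def {x : ι × Fin n → Option β | ∃ i, ∀ l, x (i, l) = none},
        ← avg_const (X := ι × Fin n → Option β) (ε/2), ← avg_add]
      apply avg_mono
      intro x
      by_cases hx : ∃ i, ∀ l, x (i, l) = none
      · rw [Set.indicator_of_mem (by exact hx)]
        have := D_le_one {w | Ψ x w ∈ S}
        linarith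
      · rw [Set.indicator_of_notMem (by exact hx)]
        push Not at hx
        linarith [hcon x hx]
    have := D_bad_le (β := β) (ι := ι) n
    linarith
  have ha : ∀ i, ∃ a, x (i, J (pat x) i) = some a := fun i =>
    Option.ne_none_iff_exists'.1 (hJ (pat x) i (hx i))
  choose a ha using ha
  let Z : (ι → β) → (ι × Fin n → Option β) := fun v p =>
    if p.2 = J (pat x) p.1 then some (v p.1) else x p
  have hΨ : ∀ w, Ψ x w = Z (fun i => op (a i) (w i)) := by
    intro w
    ext1 ⟨i, l⟩
    simp only [Ψ, Z]
    split_ifs with h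
    · rw [h, ha]; simp
    · rfl
  have hDU : ε / 2 ≤ D {v | Z v ∈ S} := by
    rw [← D_equiv (Equiv.piCongrRight fun i => Equiv.ofBijective _ (hop2 (a i))) {v | Z v ∈ S}]
    convert hxD using 2
    ext w
    simp only [Set.mem_preimage, Set.mem_ofPred_eq, hΨ]
    rfl
  obtain ⟨V, hV⟩ := hG _ hDU
  refine ⟨⟨fun p => if p.2 = J (pat x) p.1 then (V.idxFun p.1).map some id else Sum.inl (x p),
    fun e => ?_⟩, fun y => ?_⟩
  · obtain ⟨i, hi⟩ := V.proper e
    exact ⟨(i, J (pat x) i), by simp [hi]⟩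
  · refine hS _ _ ?_ (hV (fun e => (y e).getD b))
    rintro ⟨i, l⟩
    simp only [Z, Subspace.coe_apply]
    split_ifs with h
    · rcases V.idxFun i with c | c <;> simp
    · simp

lemma avg_range_le {α : Type} [Finite α] [Nonempty α] [Finite ι] (V : Subspace η α ι)
    (f : (ι → α) → ℝ) (hf : avg (fun x => f (V x)) ≤ 0) :
    avg ((Set.range fun x => V x).indicator f) ≤ 0 := by
  classical
  have := Fintype.ofFinite α
  have := Fintype.ofFinite ι
  have := Fintype.ofFinite η
  rw [avg_eq] at hf ⊢
  apply div_nonpos_of_nonpos_of_nonneg _ (by positivity)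
  have h1 : (∑ x, (Set.range fun x => V x).indicator f x) = ∑ x, f (V x) := by
    rw [← Finset.sum_image (f := f) (g := fun x => V x) (fun x _ y _ h => sub_injective V h)]
    rw [← Finset.sum_indicator_subset f (Finset.subset_univ _)]
    apply Finset.sum_congr rfl
    intro x _
    congr 1
    simp
  rw [h1]
  have hc : (0:ℝ) < Fintype.card (η → α) := by exact_mod_cast Fintype.card_pos
  by_contra! hlt
  have := div_pos hlt hc
  linarith

lemma cover_step (hM : ∀ δ : ℝ, 0 < δ → ∃ (ι : Type) (_ : Finite ι), MGood β η ι δ) (b : β)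
    {ε : ℝ} (hε : 0 < ε) : ∃ c : ℝ, 0 < c ∧ c ≤ 1 ∧ ∀ r : ℕ, ∃ (ι : Type) (_ : Finite ι),
      ∀ (S : Set (ι → Option β)) (f : (ι → Option β) → ℝ), Ins b S → (∀ x, f x ≤ 1) →
      (∀ V : Subspace η (Option β) ι, avg (fun x => f (V x)) ≤ 0) →
      avg (S.indicator f) ≤ ε + (1 - c) ^ r * (D S - ε) := by
  classical
  obtain ⟨ι, hι, hB⟩ := block hM b hε
  have hcpos : (1:ℝ) ≤ Nat.card (ι → Option β) := by
    exact_mod_cast (Nat.card_pos (α := ι → Option β))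
  refine ⟨1 / Nat.card (ι → Option β), by positivity, ?_, fun r => ?_⟩
  · rw [div_le_one (by linarith)]; exact hcpos
  set c : ℝ := 1 / Nat.card (ι → Option β) with hc
  have hc0 : 0 < c := by positivity
  have hc1 : c ≤ 1 := by rw [hc, div_le_one (by linarith)]; exact hcpos
  induction r with
  | zero =>
    refine ⟨PEmpty, inferInstance, fun S f hS hf hV => ?_⟩
    simp only [pow_zero, one_mul, add_sub_cancel]
    apply avg_mono
    intro x
    exact Set.indicator_le_indicator (hf x)
  | succ r ih =>
    obtain ⟨κ, hκ, ih⟩ := ih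
    refine ⟨ι ⊕ κ, inferInstance, fun S f hS hf hV => ?_⟩
    -- the chosen piece of each fibre
    have hch : ∀ E : Set (ι → Option β), ∃ R : Set (ι → Option β), R ⊆ E ∧
        (R = ∅ ∨ ∃ V : Subspace η (Option β) ι, R = Set.range fun x => V x) ∧
        (Ins b E → D (E \ R) - ε ≤ (1 - c) * (D E - ε)) := by
      intro E
      by_cases h : ∃ V : Subspace η (Option β) ι, ∀ x, V x ∈ E
      · obtain ⟨V, hVE⟩ := h
        have hsub : (Set.range fun x => V x) ⊆ E := by rintro _ ⟨x, rfl⟩; exact hVE x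
        refine ⟨Set.range fun x => V x, hsub, Or.inr ⟨V, rfl⟩, fun _ => ?_⟩
        have h1 := D_inter_add_diff E (Set.range fun x => V x)
        rw [Set.inter_eq_right.2 hsub] at h1
        have h2 : c ≤ D (Set.range fun x => V x) := D_pos ⟨fun _ => none, rfl⟩
        have h3 := D_le_one E
        nlinarith
      · refine ⟨∅, Set.empty_subset _, Or.inl rfl, fun hE => ?_⟩
        have : D E < ε := by
          by_contra! h4
          exact h (hB E hE h4)
        simp only [Set.sdiff_empty]
        nlinarith
    choose R hRE hRV hRD using hch
    let fib : (κ → Option β) → Set (ι → Option β) := fun t => {x | Sum.elim x t ∈ S}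
    have hfib : ∀ t, Ins b (fib t) := by
      intro t x y hxy hx
      refine hS _ _ ?_ hx
      rintro (i | i)
      · exact hxy i
      · rfl
    have hfib2 : ∀ t t', (∀ i, (t i).getD b = (t' i).getD b) → fib t = fib t' := by
      intro t t' htt
      ext x
      constructor
      · apply hS
        rintro (i | i)
        · rfl
        · exact htt i
      · apply hS
        rintro (i | i)
        · rfl
        · exact (htt i).symm
    let S' : Set (ι ⊕ κ → Option β) := {z | z ∈ S ∧ (fun i => z (Sum.inl i)) ∉
      R (fib fun j => z (Sum.inr j))}
    have hS'D : D S' - ε ≤ (1 - c) * (D S - ε) := by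
      rw [D_sumElim' S', D_sumElim' S]
      have h1 : (avg fun t : κ → Option β => D {x : ι → Option β | Sum.elim x t ∈ S'}) ≤
          avg fun t : κ → Option β =>
            (1 - c) * D {x : ι → Option β | Sum.elim x t ∈ S} + c * ε := by
        apply avg_mono
        intro t
        have h2 := hRD (fib t) (hfib t)
        have h3 : {x : ι → Option β | Sum.elim x t ∈ S'} = fib t \ R (fib t) := by
          ext x; simp [S', fib]
        rw [h3]
        change _ ≤ (1 - c) * D (fib t) + c * ε
        linarith
      rw [avg_add, avg_mul_left, avg_const] at h1
      linarith
    have hstep1 : avg (S.indicator f) ≤ avg (S'.indicator f) := by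
      rw [avg_sumElim', avg_sumElim']
      apply avg_mono
      intro t
      have h3 : ∀ x : ι → Option β, S.indicator f (Sum.elim x t) =
          S'.indicator f (Sum.elim x t) +
            (R (fib t)).indicator (fun x => f (Sum.elim x t)) x := by
        intro x
        by_cases h : x ∈ R (fib t)
        · have hx : Sum.elim x t ∈ S := hRE _ h
          have hx' : Sum.elim x t ∉ S' := by
            simp only [S', Set.mem_ofPred_eq, not_and, not_not]
            intro _; simpa using h
          simp [h, hx, hx']
        · by_cases hx : Sum.elim x t ∈ S
          · have hx' : Sum.elim x t ∈ S' := ⟨hx, by simpa using h⟩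
            simp [h, hx, hx']
          · have hx' : Sum.elim x t ∉ S' := fun h => hx h.1
            simp [h, hx, hx']
      simp only [h3]
      rw [avg_add]
      have h4 : avg ((R (fib t)).indicator (fun x => f (Sum.elim x t))) ≤ 0 := by
        rcases hRV (fib t) with h | ⟨V, h⟩
        · rw [h]; simp [avg_const]
        · rw [h]
          apply avg_range_le V
          have := hV (horiz V t)
          simpa only [horiz_apply] using this
      linarith
    have hstep2 : avg (S'.indicator f) ≤ ε + (1 - c) ^ r * (D S' - ε) := by
      rw [avg_sumElim, D_sumElim S']
      have h1 : (avg fun x : ι → Option β => avg fun y : κ → Option β =>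
          S'.indicator f (Sum.elim x y)) ≤ avg fun x : ι → Option β =>
          (1 - c) ^ r * D {y : κ → Option β | Sum.elim x y ∈ S'} + (ε - (1 - c) ^ r * ε) := by
        apply avg_mono
        intro x
        have h2 := ih {y | Sum.elim x y ∈ S'} (fun y => f (Sum.elim x y)) ?_ (fun y => hf _) ?_
        · have h3 : (avg fun y : κ → Option β => S'.indicator f (Sum.elim x y)) =
            avg ({y | Sum.elim x y ∈ S'}.indicator (fun y => f (Sum.elim x y))) := rfl
          rw [h3]
          linarith
        · intro t t' htt ht
          refine ⟨?_, ?_⟩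
          · have := hfib2 t t' htt
            have h5 : x ∈ fib t := ht.1
            rw [this] at h5
            exact h5
          · have h5 := ht.2
            simp only [Sum.elim_inl, Sum.elim_inr] at h5 ⊢
            have h6 := hfib2 t t' htt
            simp only [fib] at h5 h6 ⊢
            rwa [h6] at h5
        · intro V
          have := hV (vert x V)
          simpa only [vert_apply] using this
      rw [avg_add, avg_mul_left, avg_const] at h1
      linarith
    have hp : 0 ≤ (1 - c) ^ r := pow_nonneg (by linarith) r
    calc avg (S.indicator f) ≤ ε + (1 - c) ^ r * (D S' - ε) := hstep1.trans hstep2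
      _ ≤ ε + (1 - c) ^ r * ((1 - c) * (D S - ε)) := by gcongr
      _ = _ := by ring

/-- Insensitive sets are almost partitioned into subspaces. -/
lemma cover (hM : ∀ δ : ℝ, 0 < δ → ∃ (ι : Type) (_ : Finite ι), MGood β η ι δ) (b : β)
    {ε : ℝ} (hε : 0 < ε) : ∃ (ι : Type) (_ : Finite ι),
      ∀ (S : Set (ι → Option β)) (f : (ι → Option β) → ℝ), Ins b S → (∀ x, f x ≤ 1) →
      (∀ V : Subspace η (Option β) ι, avg (fun x => f (V x)) ≤ 0) →
      avg (S.indicator f) ≤ ε := by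
  obtain ⟨c, hc0, hc1, h⟩ := cover_step hM b (half_pos hε)
  obtain ⟨r, hr⟩ := exists_pow_lt_of_lt_one (half_pos hε) (show 1 - c < 1 by linarith)
  obtain ⟨ι, hι, h⟩ := h r
  refine ⟨ι, hι, fun S f hS hf hV => (h S f hS hf hV).trans ?_⟩
  have hp : 0 ≤ (1 - c) ^ r := pow_nonneg (by linarith) r
  have := D_le_one S
  nlinarith

end cover
end DHJ

namespace DHJ
open Combinatorics

section inter
variable {β : Type} [Finite β] [Nonempty β]

lemma Ins.pull {η ι : Type} {b : β} {S : Set (ι → Option β)} (h : Ins b S)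
    (V : Subspace η (Option β) ι) : Ins b {x | V x ∈ S} := by
  intro x y hxy hx
  refine h _ _ ?_ hx
  intro i
  simp only [Subspace.coe_apply]
  rcases V.idxFun i with a | e
  · rfl
  · exact hxy e

lemma Ins.compl {ι : Type} {b : β} {S : Set (ι → Option β)} (h : Ins b S) : Ins b Sᶜ := by
  intro x y hxy hx hy
  exact hx (h y x (fun i => (hxy i).symm) hy)

lemma cover_inter (hD : DHJP β) (L : List β) : ∀ (η : Type) [Finite η] (ε : ℝ), 0 < ε →
    ∃ (ι : Type) (_ : Finite ι),
      ∀ (S : β → Set (ι → Option β)) (f : (ι → Option β) → ℝ), (∀ b, Ins b (S b)) →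
      (∀ x, f x ≤ 1) →
      (∀ V : Subspace η (Option β) ι, avg (fun x => f (V x)) ≤ 0) →
      avg ({x | ∀ b ∈ L, x ∈ S b}.indicator f) ≤ ε := by
  induction L with
  | nil =>
    intro η _ ε hε
    refine ⟨η, inferInstance, fun S f hS hf hV => ?_⟩
    have h1 := hV ⟨Sum.inr, fun i => ⟨i, rfl⟩⟩
    have h2 : ({x | ∀ b ∈ ([] : List β), x ∈ S b}.indicator f) = f := by
      ext x; simp
    rw [h2]
    exact le_trans h1 hε.le
  | cons b L ih =>
    intro η _ ε hε
    obtain ⟨η1, hη1, ih⟩ := ih η (ε / 2) (half_pos hε)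
    obtain ⟨ι, hι, hc⟩ := cover (MDHJ hD η1) b (half_pos hε)
    refine ⟨ι, hι, fun S f hS hf hV => ?_⟩
    have h1 := hc (S b) (fun x => {x | ∀ b ∈ L, x ∈ S b}.indicator f x - ε / 2) (hS b) ?_ ?_
    · have h2 : avg ({x | ∀ b' ∈ b :: L, x ∈ S b'}.indicator f) ≤
          avg (fun x => (S b).indicator
            (fun x => {x | ∀ b ∈ L, x ∈ S b}.indicator f x - ε / 2) x + ε / 2) := by
        apply avg_mono
        intro x
        by_cases hx : x ∈ S b
        · by_cases hx' : ∀ b ∈ L, x ∈ S b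
          · rw [Set.indicator_of_mem, Set.indicator_of_mem hx, Set.indicator_of_mem]
            · linarith
            · exact hx'
            · intro b' hb'
              rcases List.mem_cons.1 hb' with rfl | h
              · exact hx
              · exact hx' _ h
          · rw [Set.indicator_of_notMem, Set.indicator_of_mem hx, Set.indicator_of_notMem]
            · linarith
            · exact hx'
            · intro h; exact hx' fun b' hb' => h b' (List.mem_cons_of_mem _ hb')
        · rw [Set.indicator_of_notMem, Set.indicator_of_notMem hx]
          · linarith
          · intro h; exact hx (h b List.mem_cons_self)
      rw [avg_add, avg_const] at h2
      linarith
    · intro x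
      by_cases hx' : ∀ b ∈ L, x ∈ S b
      · rw [Set.indicator_of_mem (by exact hx')]; linarith [hf x]
      · rw [Set.indicator_of_notMem (by exact hx')]; linarith
    · intro V
      have h3 := ih (fun b => {x | V x ∈ S b}) (fun x => f (V x)) (fun b => (hS b).pull V)
        (fun x => hf _) (fun U => by
          have := hV (comp V U)
          simpa only [comp_apply] using this)
      rw [avg_sub, avg_const]
      have h4 : (avg fun x => {x | ∀ b ∈ L, x ∈ S b}.indicator f (V x)) =
        avg ({x | ∀ b ∈ L, x ∈ {x | V x ∈ S b}}.indicator fun x => f (V x)) := rfl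
      rw [h4]
      linarith

end inter

section GR

lemma folkman_aux (n : ℕ) : ∃ (ι : Type) (_ : Finite ι), ∀ C : (ι → Bool) → Bool,
    ∃ (g : ι → Option (Fin n)) (c : Fin n → Bool), (∀ e, ∃ i, g i = some e) ∧
    ∀ (x : Fin n → Bool) (e : Fin n), x e = true → (∀ e' < e, x e' = false) →
      C (fun i => (g i).elim false x) = c e := by
  induction n with
  | zero => exact ⟨PEmpty, inferInstance, fun C => ⟨fun i => i.elim, fun e => e.elim0,
      fun e => e.elim0, fun x e => e.elim0⟩⟩
  | succ n ih =>
    obtain ⟨ι', hι', ih⟩ := ih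
    obtain ⟨ι, hι, hHJ⟩ := Subspace.exists_mono_in_high_dimension Bool Bool ι'
    refine ⟨Option ι, inferInstance, fun C => ?_⟩
    obtain ⟨l, c0, hl⟩ := hHJ (fun x => C (fun i => i.elim true x))
    obtain ⟨g, c, hg, hgc⟩ := ih (fun y => C (fun i => i.elim false
      (fun i => (l.idxFun i).elim (fun _ => false) y)))
    refine ⟨fun i => i.elim (some 0) (fun i => (l.idxFun i).elim
      (fun a => if a then some 0 else none) (fun j => (g j).map Fin.succ)),
      Fin.cons c0 c, ?_, ?_⟩
    · intro e
      refine Fin.cases ⟨none, rfl⟩ (fun e => ?_) e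
      obtain ⟨j, hj⟩ := hg e
      obtain ⟨i, hi⟩ := l.proper j
      exact ⟨some i, by simp [hi, hj]⟩
    · intro x e
      refine Fin.cases ?_ (fun e => ?_) e
      · intro hx _
        rw [Fin.cons_zero, ← hl (fun j => (g j).elim false fun e => x e.succ)]
        congr 1
        ext1 i
        cases i with
        | none => simpa using hx
        | some i =>
          simp only [Option.elim_some, Subspace.coe_apply]
          rcases l.idxFun i with a | j
          · cases a <;> simp [hx]
          · simp only [Sum.elim_inr]
            cases g j <;> simp
      · intro hx hx'
        have hx0 : x 0 = false := hx' 0 (Fin.succ_pos e)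
        rw [Fin.cons_succ, ← hgc (fun e => x e.succ) e hx
          (fun e' he' => hx' _ (Fin.succ_lt_succ_iff.2 he'))]
        congr 1
        ext1 i
        cases i with
        | none => simpa using hx0
        | some i =>
          simp only [Option.elim_some]
          rcases l.idxFun i with a | j
          · cases a <;> simp [hx0]
          · simp only [Sum.elim_inr]
            cases g j <;> simp

lemma folkman (η : Type) [Finite η] : ∃ (ι : Type) (_ : Finite ι), ∀ C : (ι → Bool) → Bool,
    ∃ (g : ι → Option η) (c : Bool), (∀ e, ∃ i, g i = some e) ∧
    ∀ (x : η → Bool), (∃ e, x e = true) → C (fun i => (g i).elim false x) = c := by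
  classical
  have := Fintype.ofFinite η
  obtain ⟨ι, hι, h⟩ := folkman_aux (2 * Fintype.card η)
  refine ⟨ι, hι, fun C => ?_⟩
  obtain ⟨g, c, hg, hc⟩ := h C
  obtain ⟨v, hv⟩ : ∃ v : Bool, Fintype.card η ≤ Fintype.card {e // c e = v} := by
    by_contra! hcon
    have h1 := hcon true
    have h2 := hcon false
    rw [Fintype.card_subtype] at h1 h2
    have h3 : (Finset.univ.filter fun e => c e = true).card +
        (Finset.univ.filter fun e => c e = false).card = 2 * Fintype.card η := by
      have := Finset.card_filter_add_card_filter_not (s := (Finset.univ : Finset (Fin (2 * Fintype.card η)))) (fun e => c e = true)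
      simpa using this
    omega
  obtain ⟨h⟩ := Function.Embedding.nonempty_of_card_le hv
  let k : Fin (2 * Fintype.card η) → Option η := fun e =>
    if hh : ∃ j, (h j : Fin _) = e then some hh.choose else none
  have hk : ∀ j, k (h j) = some j := by
    intro j
    have hh : ∃ j', (h j' : Fin (2 * Fintype.card η)) = h j := ⟨j, rfl⟩
    simp only [k, dif_pos hh]
    congr 1
    exact h.injective (Subtype.ext hh.choose_spec)
  have hk' : ∀ e j, k e = some j → e = h j := by
    intro e j hej
    simp only [k] at hej
    split_ifs at hej with hh
    · have := hh.choose_spec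
      rw [Option.some.inj hej] at this
      exact this.symm
  refine ⟨fun i => (g i).bind k, v, fun j => ?_, fun x hx => ?_⟩
  · obtain ⟨i, hi⟩ := hg (h j)
    exact ⟨i, by simp [hi, hk]⟩
  · let x' : Fin (2 * Fintype.card η) → Bool := fun e => (k e).elim false x
    have hne : (Finset.univ.filter fun e => x' e = true).Nonempty := by
      obtain ⟨j, hj⟩ := hx
      exact ⟨h j, by simp [x', hk, hj]⟩
    have hmem := Finset.min'_mem _ hne
    set e := Finset.min' _ hne with he
    have hxe : x' e = true := by simpa using hmem
    have h1 := hc x' e hxe (fun e' he' => by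
      by_contra hcon
      have : e ≤ e' := Finset.min'_le _ _ (by simpa using hcon)
      exact absurd he' (not_lt.2 this))
    have h2 : c e = v := by
      simp only [x'] at hxe
      cases hke : k e with
      | none => simp [hke] at hxe
      | some j => rw [hk' _ _ hke]; exact (h j).2
    rw [← h2, ← h1]
    congr 1
    ext1 i
    rcases hgi : g i with _ | j <;> simp [x', hgi]

variable {β : Type} [Finite β] [Nonempty β]

/-- color depends only on positions of `none` -/
lemma insens (η : Type) [Finite η] : ∀ (κ : Type) [Finite κ], ∃ (ι : Type) (_ : Finite ι),
    ∀ C : (ι → Option β) → κ, ∃ W : Subspace η β ι, ∀ y y' : η → Option β,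
      (∀ e, y e = none ↔ y' e = none) → C (opt W y) = C (opt W y') := by
  refine Finite.induction_empty_option
    (P := fun η => ∀ (κ : Type) [Finite κ], ∃ (ι : Type) (_ : Finite ι),
    ∀ C : (ι → Option β) → κ, ∃ W : Subspace η β ι, ∀ y y' : η → Option β,
      (∀ e, y e = none ↔ y' e = none) → C (opt W y) = C (opt W y')) ?_ ?_ ?_ η
  · intro η η' e ih κ _
    obtain ⟨ι, hι, h⟩ := ih κ
    refine ⟨ι, hι, fun C => ?_⟩
    obtain ⟨W, hW⟩ := h C
    refine ⟨W.reindex e (Equiv.refl _) (Equiv.refl _), fun y y' hy => ?_⟩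
    have h1 : ∀ y : η' → Option β, opt (W.reindex e (Equiv.refl _) (Equiv.refl _)) y
        = opt W (y ∘ e) := by
      intro y
      ext1 i
      simp only [opt_apply, Subspace.reindex]
      cases h : W.idxFun i <;> simp [h]
    rw [h1, h1]
    exact hW _ _ fun j => hy _
  · intro κ _
    refine ⟨PEmpty, inferInstance, fun C => ?_⟩
    refine ⟨⟨fun i => i.elim, fun i => i.elim⟩, fun y y' hy => ?_⟩
    congr 1
    ext1 i
    exact i.elim
  · intro η _ ih κ _
    obtain ⟨ι2, hι2, ih⟩ := ih (Option β → κ)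
    obtain ⟨ι1, hι1, h1⟩ := Subspace.exists_mono_in_high_dimension β ((ι2 → Option β) → κ) Unit
    refine ⟨ι1 ⊕ ι2, inferInstance, fun C => ?_⟩
    obtain ⟨l, c, hl⟩ := h1 (fun x z => C (Sum.elim (fun i => some (x i)) z))
    obtain ⟨W, hW⟩ := ih (fun z a => C (Sum.elim (opt l (fun _ => a)) z))
    refine ⟨prodOpt l W, fun y y' hy => ?_⟩
    rw [opt_prodOpt, opt_prodOpt]
    have h2 := congrFun (hW (fun e => y (some e)) (fun e => y' (some e)) fun e => hy _) (y none)
    rw [show C (Sum.elim (opt l fun _ => y none) (opt W fun e => y (some e))) =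
      C (Sum.elim (opt l fun _ => y none) (opt W fun e => y' (some e))) from h2]
    rcases hyn : y none with _ | a
    · rw [(hy none).1 hyn]
    · rcases hyn' : y' none with _ | a'
      · rw [(hy none).2 hyn'] at hyn; simp at hyn
      · have e1 : opt l (fun _ => some a) = fun i => some (l (fun _ => a) i) := opt_some l _
        have e2 : opt l (fun _ => some a') = fun i => some (l (fun _ => a') i) := opt_some l _
        rw [e1, e2]
        exact (congrFun (hl fun _ => a) _).trans (congrFun (hl fun _ => a') _).symm

/-- Graham-Rothschild for lines. -/
lemma graham_rothschild (η : Type) [Finite η] : ∃ (ι : Type) (_ : Finite ι),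
    ∀ C : Set (ι → Option β), ∃ W : Subspace η β ι,
      (∀ y : η → Option β, (∃ e, y e = none) → opt W y ∈ C) ∨
      (∀ y : η → Option β, (∃ e, y e = none) → opt W y ∉ C) := by
  classical
  obtain ⟨b0⟩ := ‹Nonempty β›
  have : Nonempty β := ⟨b0⟩
  obtain ⟨ι', hι', hF⟩ := folkman η
  obtain ⟨ι, hι, hI⟩ := insens (β := β) ι' Bool
  refine ⟨ι, hι, fun C => ?_⟩
  obtain ⟨W1, hW1⟩ := hI (fun z => decide (z ∈ C))
  obtain ⟨g, c, hg, hc⟩ := hF (fun x => decide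
    (opt W1 (fun i => if x i then none else some b0) ∈ C))
  let W2 : Subspace η β ι' := ⟨fun i => (g i).elim (Sum.inl b0) Sum.inr, fun e => by
    obtain ⟨i, hi⟩ := hg e
    exact ⟨i, by simp [hi]⟩⟩
  have key : ∀ y : η → Option β, (∃ e, y e = none) →
      decide (opt (comp W1 W2) y ∈ C) = c := by
    intro y hy
    rw [opt_comp, ← hc (fun e => (y e).isNone) (by simpa using hy)]
    apply hW1
    intro i
    rw [opt_apply]
    rcases hgi : g i with _ | j <;> simp [W2, hgi]
  refine ⟨comp W1 W2, ?_⟩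
  cases c
  · right; intro y hy; simpa using key y hy
  · left; intro y hy; simpa using key y hy

end GR
end DHJ

namespace DHJ
open Combinatorics

variable {β : Type} [Finite β] [Nonempty β]

lemma cover_compl (hD : DHJP β) (η : Type) [Finite η] {ε : ℝ} (hε : 0 < ε) :
    ∃ (ι : Type) (_ : Finite ι), ∀ (κ : Type) [Finite κ],
      ∀ (S : β → Set (ι ⊕ κ → Option β)) (f : (ι ⊕ κ → Option β) → ℝ), (∀ b, Ins b (S b)) →
      (∀ x, f x ≤ 1) →
      (∀ V : Subspace η (Option β) (ι ⊕ κ), avg (fun x => f (V x)) ≤ 0) →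
      avg ({x | ∀ b, x ∈ S b}ᶜ.indicator f) ≤ ε := by
  classical
  have := Fintype.ofFinite β
  have hk : (0:ℝ) < Fintype.card β := by exact_mod_cast Fintype.card_pos
  obtain ⟨ι, hι, hc⟩ := cover_inter hD (Finset.univ : Finset β).toList η (ε / Fintype.card β)
    (by positivity)
  refine ⟨ι, hι, fun κ _ S f hS hf hV => ?_⟩
  let e := Fintype.equivFin β
  let T : β → β → Set (ι ⊕ κ → Option β) := fun j b =>
    if e b < e j then S b else if b = j then (S b)ᶜ else Set.univ
  have hT : ∀ j b, Ins b (T j b) := by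
    intro j b
    simp only [T]
    split_ifs
    · exact hS b
    · exact (hS b).compl
    · intro x y _ _; trivial
  have hsum : {x | ∀ b, x ∈ S b}ᶜ.indicator f =
      fun x => ∑ j, {x | ∀ b, x ∈ T j b}.indicator f x := by
    ext x
    by_cases hx : ∀ b, x ∈ S b
    · rw [Set.indicator_of_notMem (by simpa using hx), Finset.sum_eq_zero]
      intro j _
      apply Set.indicator_of_notMem
      intro h
      have := h j
      simp [T] at this
      exact this (hx j)
    · rw [Set.indicator_of_mem (by simpa using hx)]
      have hne : (Finset.univ.filter fun i => x ∉ S (e.symm i)).Nonempty := by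
        push Not at hx
        obtain ⟨b, hb⟩ := hx
        exact ⟨e b, by simpa using hb⟩
      have hmem := Finset.min'_mem _ hne
      have hmin := fun i hi => Finset.min'_le (Finset.univ.filter fun i => x ∉ S (e.symm i)) i hi
      set i0 := Finset.min' _ hne with hi0
      have h0 : x ∉ S (e.symm i0) := by simpa using hmem
      have h1 : ∀ b, e b < i0 → x ∈ S b := by
        intro b hb
        by_contra hcon
        exact absurd (hmin (e b) (by simpa using hcon)) (not_le.2 hb)
      rw [Finset.sum_eq_single (e.symm i0)]
      · rw [Set.indicator_of_mem]
        intro b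
        simp only [T, Equiv.apply_symm_apply]
        split_ifs with h2 h3
        · exact h1 b h2
        · rw [h3]; exact h0
        · trivial
      · intro j _ hj
        apply Set.indicator_of_notMem
        intro h
        rcases lt_trichotomy (e j) i0 with h2 | h2 | h2
        · have := h j
          simp only [T, lt_irrefl, if_false, if_true] at this
          exact this (h1 j h2)
        · exact hj (by rw [← h2]; simp)
        · have := h (e.symm i0)
          simp only [T, Equiv.apply_symm_apply, h2, if_true] at this
          exact h0 this
      · simp
  rw [hsum, avg_sum]
  have hterm : ∀ j, avg ({x | ∀ b, x ∈ T j b}.indicator f) ≤ ε / Fintype.card β := by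
    intro j
    rw [avg_sumElim']
    apply avg_le
    intro t
    have h1 := hc (fun b => {x | Sum.elim x t ∈ T j b}) (fun x => f (Sum.elim x t)) ?_
      (fun x => hf _) ?_
    · convert h1 using 2
      ext x
      simp [Set.indicator_apply]
    · intro b x y hxy hx
      refine hT j b _ _ ?_ hx
      rintro (i | i)
      · exact hxy i
      · rfl
    · intro V
      have := hV (horiz V t)
      simpa only [horiz_apply] using this
  refine (Finset.sum_le_sum fun j _ => hterm j).trans ?_
  rw [Finset.sum_const, Finset.card_univ, nsmul_eq_mul]
  field_simp
  exact le_rfl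

lemma fiber_lower {X : Type} [Finite X] [Nonempty X] {f : X → ℝ} {u v : ℝ} (hf : ∀ x, f x ≤ u)
    (hv : v ≤ avg f) (x : X) : u - Nat.card X * (u - v) ≤ f x := by
  have := Fintype.ofFinite X
  have hc : (0:ℝ) < Fintype.card X := by exact_mod_cast Fintype.card_pos
  have h1 : u - f x ≤ ∑ x, (u - f x) :=
    Finset.single_le_sum (f := fun x => u - f x) (fun x _ => by linarith [hf x]) (Finset.mem_univ x)
  rw [Finset.sum_sub_distrib, Finset.sum_const, Finset.card_univ, nsmul_eq_mul] at h1
  rw [avg_eq, le_div_iff₀ hc] at hv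
  rw [Nat.card_eq_fintype_card]
  linarith

lemma D_some_lt : D ({none}ᶜ : Set (Option β)) < 1 := by
  rw [D_compl]
  have : (1:ℝ) / Nat.card (Option β) ≤ D ({none} : Set (Option β)) := D_pos rfl
  have h2 : (0:ℝ) < Nat.card (Option β) := by exact_mod_cast Nat.card_pos
  have : (0:ℝ) < 1 / Nat.card (Option β) := by positivity
  linarith

lemma D_nonone_le {ι κ : Type} [Finite ι] [Finite κ] :
    D {x : ι ⊕ κ → Option β | ∀ i, x i ≠ none} ≤ (D ({none}ᶜ : Set (Option β))) ^ (Nat.card κ) := by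
  have := Fintype.ofFinite κ
  rw [D_sumElim]
  apply avg_le
  intro x
  refine (D_mono (S := {y | Sum.elim x y ∈ {x : ι ⊕ κ → Option β | ∀ i, x i ≠ none}})
    (T := {y : κ → Option β | ∀ i, y i ∈ ({none}ᶜ : Set (Option β))})
    (fun y hy i => hy (Sum.inr i))).trans ?_
  rw [D_pi]
  simp

/-- the combinatorial line of a template, in `Option β`, times a point -/
def tline {ι κ : Type} (y : ι → Option β) (hy : ∃ i, y i = none) (t : κ → Option β) :
    Subspace Unit (Option β) (ι ⊕ κ) where
  idxFun := Sum.elim (fun i => (y i).elim (Sum.inr ()) (fun b => Sum.inl (some b)))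
    (fun j => Sum.inl (t j))
  proper _ := by
    obtain ⟨i, hi⟩ := hy
    exact ⟨Sum.inl i, by simp [hi]⟩

lemma tline_none {ι κ : Type} (y : ι → Option β) (hy : ∃ i, y i = none) (t : κ → Option β)
    (z : Unit → Option β) (hz : z () = none) : tline y hy t z = Sum.elim y t := by
  ext1 i
  rcases i with i | i
  · simp only [Subspace.coe_apply, tline, Sum.elim_inl]
    cases y i <;> simp [hz]
  · simp [Subspace.coe_apply, tline]

lemma tline_some {ι κ : Type} (y : ι → Option β) (hy : ∃ i, y i = none) (t : κ → Option β)
    (z : Unit → Option β) (b : β) (hz : z () = some b) :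
    tline y hy t z = Sum.elim (fun i => some ((y i).getD b)) t := by
  ext1 i
  rcases i with i | i
  · simp only [Subspace.coe_apply, tline, Sum.elim_inl]
    cases y i <;> simp [hz]
  · simp [Subspace.coe_apply, tline]

end DHJ

namespace DHJ
open Combinatorics

variable {β : Type} [Finite β] [Nonempty β]

def LineFree {α ι : Type} (A : Set (ι → α)) : Prop := ∀ V : Subspace Unit α ι, ∃ x, V x ∉ A

/-- sections -/
def SS {η ι κ : Type} (W : Subspace η β ι) (A : Set (ι ⊕ κ → Option β)) (t : κ → Option β) (b : β) :
    Set (η → Option β) :=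
  {x | (Sum.elim (fun i => some (W (fun e => (x e).getD b) i)) t : ι ⊕ κ → Option β) ∈ A}

lemma SS_ins {η ι κ : Type} (W : Subspace η β ι) (A : Set (ι ⊕ κ → Option β)) (t : κ → Option β)
    (b : β) : Ins b (SS W A t b) := by
  intro x y hxy hx
  have : (fun e => (x e).getD b) = fun e => (y e).getD b := funext hxy
  simp only [SS, Set.mem_ofPred_eq] at hx ⊢
  rw [← this]; exact hx

lemma core1 {η ι κ : Type} [Finite η] [Finite ι] [Finite κ] (W : Subspace η β ι)
    (A : Set (ι ⊕ κ → Option β)) (hA : LineFree A) {δ θ : ℝ} (hδ : 0 < δ) (hθ : 0 < θ) (hθ1 : θ ≤ 1)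
    (hfib : ∀ x, δ - δ * θ / 8 ≤ D {t : κ → Option β | Sum.elim x t ∈ A})
    (hC : ∀ y : η → Option β, (∃ e, y e = none) →
      θ ≤ D {t : κ → Option β | ∀ b, y ∈ SS W A t b})
    (hn : D {x : η → Option β | ∀ i, x i ≠ none} ≤ θ / 16) :
    ∃ t : κ → Option β, δ * θ / 2 ≤ avg ({x | ∀ b, x ∈ SS W A t b}ᶜ.indicator
      (fun x => A.indicator (fun _ => (1:ℝ)) (Sum.elim (opt W x) t) - δ)) := by
  classical
  let F : (η → Option β) → (κ → Option β) → ℝ := fun x t => {x | ∀ b, x ∈ SS W A t b}ᶜ.indicator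
      (fun x => A.indicator (fun _ => (1:ℝ)) (Sum.elim (opt W x) t) - δ) x
  have hFge : ∀ x t, -δ ≤ F x t := by
    intro x t
    simp only [F, Set.indicator_apply]
    split_ifs <;> linarith
  have h1 : ∀ x, (∃ e, x e = none) → 7 * δ * θ / 8 ≤ avg (F x) := by
    intro x hx
    have hval : F x = fun t => ({t : κ → Option β | Sum.elim (opt W x) t ∈ A}.indicator
        (fun _ => (1:ℝ)) t - δ) + δ * {t : κ → Option β | ∀ b, x ∈ SS W A t b}.indicator
        (fun _ => (1:ℝ)) t := by
      ext t
      simp only [F, Set.indicator_apply, Set.mem_compl_iff, Set.mem_ofPred_eq]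
      by_cases hT : ∀ b, x ∈ SS W A t b
      · have hnot : Sum.elim (opt W x) t ∉ A := by
          intro hmem
          have hnone : ∃ i, opt W x i = none := by
            obtain ⟨e, he⟩ := hx
            obtain ⟨i, hi⟩ := W.proper e
            exact ⟨i, by rw [opt_apply, hi]; simpa using he⟩
          obtain ⟨z, hz⟩ := hA (tline (opt W x) hnone t)
          apply hz
          rcases h : z () with _ | b
          · rw [tline_none _ _ _ _ h]; exact hmem
          · rw [tline_some _ _ _ _ b h]
            have := hT b
            simp only [SS, Set.mem_ofPred_eq] at this
            simpa only [opt_getD] using this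
        simp [hT, hnot]
      · simp [hT]
    rw [hval, avg_add, avg_sub, avg_mul_left, avg_const]
    have h2 := hfib (opt W x)
    have h3 := mul_le_mul_of_nonneg_left (hC x hx) hδ.le
    simp only [D] at h2 h3
    linarith
  have h2 : ∀ x, 7 * δ * θ / 8 - (δ + 7 * δ * θ / 8) * {x : η → Option β | ∀ i, x i ≠ none}.indicator
      (fun _ => (1:ℝ)) x ≤ avg (F x) := by
    intro x
    by_cases hx : ∃ e, x e = none
    · have : x ∉ {x : η → Option β | ∀ i, x i ≠ none} := by simpa using hx
      rw [Set.indicator_of_notMem this]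
      linarith [h1 x hx]
    · have : x ∈ {x : η → Option β | ∀ i, x i ≠ none} := by simpa using hx
      rw [Set.indicator_of_mem this]
      linarith [le_avg (hFge x)]
  have h3 := avg_mono h2
  rw [avg_sub, avg_mul_left, avg_const, avg_comm] at h3
  obtain ⟨t, ht⟩ := exists_avg_le (fun t => avg fun x => F x t)
  refine ⟨t, le_trans ?_ (h3.trans ht)⟩
  have h4 : (δ + 7 * δ * θ / 8) * D {x : η → Option β | ∀ i, x i ≠ none} ≤ (2 * δ) * (θ / 16) := by
    apply mul_le_mul _ hn (D_nonneg _) (by positivity)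
    nlinarith
  simp only [D] at h4
  have : 0 < δ * θ := by positivity
  linarith

lemma core2 {η ι κ ι0 : Type} [Finite η] [Finite ι] [Finite κ] [Finite ι0] (W : Subspace η β ι)
    (U : Subspace ι0 β η) (A : Set (ι ⊕ κ → Option β)) {δ : ℝ} (hδ : 0 < δ)
    (hfib : ∀ x, δ / 2 ≤ D {t : κ → Option β | Sum.elim x t ∈ A})
    (hg : MGood β Unit ι0 (δ / 4)) (hne : Nonempty (Subspace Unit β ι0)) :
    ∃ y : η → Option β, (∃ e, y e = none) ∧
      δ / 4 / Nat.card (Subspace Unit β ι0) ≤ D {t : κ → Option β | ∀ b, y ∈ SS W A t b} := by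
  have h1 : δ / 2 ≤ avg fun x : ι0 → β => D {t : κ → Option β |
      (Sum.elim (fun i => some (comp W U x i)) t : ι ⊕ κ → Option β) ∈ A} :=
    le_avg fun x => hfib _
  rw [D_avg_comm] at h1
  have h2 := markov (fun x => D_le_one _) (by positivity) h1
  rw [show δ / 2 / 2 = δ / 4 by ring] at h2
  obtain ⟨l, hl⟩ := pigeon {t : κ → Option β | δ / 4 ≤ D {x : ι0 → β |
      (Sum.elim (fun i => some (comp W U x i)) t : ι ⊕ κ → Option β) ∈ A}} (fun (l : Subspace Unit β ι0) => {t : κ → Option β | ∀ z,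
      (Sum.elim (fun i => some (comp W U (l z) i)) t : ι ⊕ κ → Option β) ∈ A}) (fun t ht => hg {x : ι0 → β |
      (Sum.elim (fun i => some (comp W U x i)) t : ι ⊕ κ → Option β) ∈ A} ht)
  refine ⟨opt (comp U l) (fun _ => none), ?_, ?_⟩
  · obtain ⟨i, hi⟩ := (comp U l).proper ()
    exact ⟨i, by rw [opt_apply, hi]; rfl⟩
  · refine le_trans (div_le_div_of_nonneg_right h2 (Nat.cast_nonneg _)) (hl.trans (D_mono ?_))
    intro t ht b
    have := ht (fun _ => b)
    simp only [SS, Set.mem_ofPred_eq]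
    simp only [opt_getD]
    simpa only [comp_apply, Option.getD_none] using this

/-- The density increment-free induction step. -/
lemma dhj_step (hD : DHJP β) : DHJP (Option β) := by
  classical
  by_contra hcon
  obtain ⟨δ1, hδ1, hnP⟩ : ∃ δ1 : ℝ, 0 < δ1 ∧
      ¬ ∃ (ι : Type) (_ : Finite ι), MGood (Option β) Unit ι δ1 := by
    simpa only [DHJP, not_forall, exists_prop] using hcon
  let P : ℝ → Prop := fun δ => ∃ (ι : Type) (_ : Finite ι), MGood (Option β) Unit ι δ
  have hmono : ∀ a b, P a → a ≤ b → P b := by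
    rintro a b ⟨ι, hι, h⟩ hab
    exact ⟨ι, hι, h.mono hab⟩
  have hP2 : P 2 := ⟨Unit, inferInstance, fun A hA => by
    have := D_le_one A
    linarith⟩
  let Q : Set ℝ := {δ | P δ}
  have hbdd : ∀ a ∈ Q, δ1 ≤ a := by
    intro a ha
    by_contra hlt
    exact hnP (hmono a δ1 ha (not_le.1 hlt).le)
  set δ := sInf Q with hδdef
  have hδlower : δ1 ≤ δ := le_csInf ⟨2, hP2⟩ hbdd
  have hδ2 : δ ≤ 2 := csInf_le ⟨δ1, hbdd⟩ hP2
  have hδ : 0 < δ := lt_of_lt_of_le hδ1 hδlower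
  have hup : ∀ ε > 0, P (δ + ε) := by
    intro ε hε
    obtain ⟨a, ha, hlt⟩ := exists_lt_of_csInf_lt ⟨2, hP2⟩ (show sInf Q < δ + ε by linarith)
    exact hmono a _ ha hlt.le
  have hdown : ∀ ε > 0, ¬ P (δ - ε) := by
    intro ε hε h
    have := csInf_le ⟨δ1, hbdd⟩ h
    linarith
  clear_value δ
  obtain ⟨ι0, hι0, hg0⟩ := hD (δ / 4) (by positivity)
  have hne : Nonempty (Subspace Unit β ι0) := by
    obtain ⟨V, _⟩ := hg0 Set.univ (by rw [D_univ]; linarith)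
    exact ⟨V⟩
  set N0 : ℝ := (Nat.card (Subspace Unit β ι0) : ℝ) with hN0
  have hN0pos : 1 ≤ N0 := by
    rw [hN0]; exact_mod_cast Nat.card_pos
  set θ := δ / 4 / N0 with hθdef
  have hθ : 0 < θ := by positivity
  have hθ1 : θ ≤ 1 := by
    rw [hθdef, div_le_one (by linarith)]; linarith
  have hδθ : 0 < δ * θ := by positivity
  obtain ⟨ι', hι', hg'⟩ := hup (δ * θ / 8) (by positivity)
  obtain ⟨η1, hη1, hcov⟩ := cover_compl hD ι' (ε := δ * θ / 8) (by positivity)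
  obtain ⟨n, hn⟩ := exists_pow_lt_of_lt_one (show 0 < θ / 16 by positivity) (D_some_lt (β := β))
  let η := η1 ⊕ (ι0 ⊕ Fin n)
  have hnn : D {x : η → Option β | ∀ i, x i ≠ none} ≤ θ / 16 := by
    refine D_nonone_le.trans (le_trans ?_ hn.le)
    apply pow_le_pow_of_le_one (D_nonneg _) (D_le_one _)
    simp
  obtain ⟨ιM, hιM, hGR⟩ := graham_rothschild (β := β) η
  set N : ℝ := (Nat.card (ιM → Option β) : ℝ) with hN
  have hNpos : 1 ≤ N := by
    rw [hN]; exact_mod_cast Nat.card_pos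
  set ε := δ * θ / (16 * N) with hεdef
  have hε : 0 < ε := by positivity
  have hNε : N * ε = δ * θ / 16 := by rw [hεdef]; field_simp
  obtain ⟨κ, hκ, hgκ⟩ := hup ε hε
  obtain ⟨A, hDA, hA⟩ : ∃ A : Set (ιM ⊕ κ → Option β), δ - ε ≤ D A ∧ LineFree A := by
    by_contra hno
    apply hdown ε hε
    refine ⟨ιM ⊕ κ, inferInstance, fun A hDA => ?_⟩
    by_contra hV
    apply hno
    refine ⟨A, hDA, ?_⟩
    simpa [LineFree] using hV
  have hfu : ∀ x, D {t : κ → Option β | Sum.elim x t ∈ A} ≤ δ + ε := by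
    intro x
    by_contra hlt
    obtain ⟨V, hV⟩ := hgκ _ (not_le.1 hlt).le
    obtain ⟨z, hz⟩ := hA (vert x V)
    rw [vert_apply] at hz
    exact hz (hV z)
  have hfib : ∀ x, δ - δ * θ / 8 ≤ D {t : κ → Option β | Sum.elim x t ∈ A} := by
    intro x
    rw [D_sumElim] at hDA
    have := fiber_lower hfu hDA x
    rw [← hN] at this
    nlinarith
  have hfib2 : ∀ x, δ / 2 ≤ D {t : κ → Option β | Sum.elim x t ∈ A} := by
    intro x
    have := hfib x
    nlinarith
  obtain ⟨W, hW⟩ := hGR {y | θ ≤ D {t : κ → Option β | ∀ b,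
    (Sum.elim (fun i => some ((y i).getD b)) t : ιM ⊕ κ → Option β) ∈ A}}
  have hW' : ∀ y : η → Option β, opt W y ∈ {y | θ ≤ D {t : κ → Option β | ∀ b,
    (Sum.elim (fun i => some ((y i).getD b)) t : ιM ⊕ κ → Option β) ∈ A}} ↔
      θ ≤ D {t : κ → Option β | ∀ b, y ∈ SS W A t b} := by
    intro y
    simp only [Set.mem_ofPred_eq, SS, opt_getD]
  have hC : ∀ y : η → Option β, (∃ e, y e = none) →
      θ ≤ D {t : κ → Option β | ∀ b, y ∈ SS W A t b} := by
    rcases hW with hW | hW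
    · intro y hy
      exact (hW' y).1 (hW y hy)
    · exfalso
      obtain ⟨b0⟩ := ‹Nonempty β›
      let idS : Subspace ι0 β ι0 := ⟨Sum.inr, fun e => ⟨e, rfl⟩⟩
      let U : Subspace ι0 β η := vert (fun _ => b0) (horiz idS (fun _ => b0))
      obtain ⟨y, hy, hy2⟩ := core2 W U A hδ hfib2 hg0 hne
      exact hW y hy ((hW' y).2 hy2)
  obtain ⟨t, ht⟩ := core1 W A hA hδ hθ hθ1 hfib hC hnn
  have hfin := hcov (ι0 ⊕ Fin n) (SS W A t)
    (fun x => A.indicator (fun _ => (1:ℝ)) (Sum.elim (opt W x) t) - δ - δ * θ / 8)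
    (SS_ins W A t) ?_ ?_
  · have h5 : avg ({x | ∀ b, x ∈ SS W A t b}ᶜ.indicator
        (fun x => A.indicator (fun _ => (1:ℝ)) (Sum.elim (opt W x) t) - δ)) - δ * θ / 8 ≤
        avg ({x | ∀ b, x ∈ SS W A t b}ᶜ.indicator
        (fun x => A.indicator (fun _ => (1:ℝ)) (Sum.elim (opt W x) t) - δ - δ * θ / 8)) := by
      rw [← avg_const (X := η → Option β) (δ * θ / 8), ← avg_sub]
      apply avg_mono
      intro x
      rw [avg_const]
      by_cases hx : x ∈ {x | ∀ b, x ∈ SS W A t b}ᶜ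
      · rw [Set.indicator_of_mem hx, Set.indicator_of_mem hx]
      · rw [Set.indicator_of_notMem hx, Set.indicator_of_notMem hx]; linarith
    linarith
  · intro x
    have := ind_le_one A (Sum.elim (opt W x) t)
    linarith
  · intro V
    rw [avg_sub, avg_sub, avg_const, avg_const]
    by_contra hlt
    push Not at hlt
    obtain ⟨l, hl⟩ := hg' {x | Sum.elim (opt W (V x)) t ∈ A} (by
      have : D {x | Sum.elim (opt W (V x)) t ∈ A} =
        avg fun x => A.indicator (fun _ => (1:ℝ)) (Sum.elim (opt W (V x)) t) := rfl
      linarith)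
    obtain ⟨z, hz⟩ := hA (horiz (comp (opt W) (comp V l)) t)
    rw [horiz_apply, comp_apply, comp_apply] at hz
    exact hz (hl z)

lemma DHJP.equiv {β γ : Type} [Finite β] [Finite γ] (e : β ≃ γ) (h : DHJP β) : DHJP γ := by
  intro δ hδ
  obtain ⟨ι, hι, hg⟩ := h δ hδ
  refine ⟨ι, hι, fun A hA => ?_⟩
  rw [← D_equiv ((Equiv.refl ι).arrowCongr e)] at hA
  obtain ⟨V, hV⟩ := hg _ hA
  refine ⟨⟨fun i => (V.idxFun i).map e id, fun j => ?_⟩, fun x => ?_⟩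
  · obtain ⟨i, hi⟩ := V.proper j
    exact ⟨i, by simp [hi]⟩
  · have := hV (fun j => e.symm (x j))
    rw [Set.mem_preimage] at this
    convert this using 1
    ext1 i
    simp only [Subspace.coe_apply, Equiv.arrowCongr_apply, Function.comp]
    simp only [Equiv.coe_refl, Equiv.refl_symm, id]
    rcases h : V.idxFun i with a | j <;> simp [Subspace.coe_apply, h]

lemma dhj_unit : DHJP Unit := by
  intro δ hδ
  refine ⟨Unit, inferInstance, fun A hA => ?_⟩
  obtain ⟨a, ha⟩ := D_nonempty (hδ.trans_le hA)
  refine ⟨⟨Sum.inr, fun e => ⟨e, rfl⟩⟩, fun x => ?_⟩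
  convert ha

lemma dhj (k : ℕ) : DHJP (Fin (k + 1)) := by
  induction k with
  | zero => exact dhj_unit.equiv (Fintype.equivOfCardEq (by simp))
  | succ k ih => exact (dhj_step ih).equiv (finSuccEquiv (k + 1)).symm

end DHJ

namespace DHJ
open Combinatorics

section bsg
variable {V : Type}
open Classical in
lemma cnt (A : Finset V) (p : V → Prop) :
    ((A.filter p).card : ℝ) = ∑ a ∈ A, if p a then (1:ℝ) else 0 := by
  rw [Finset.sum_boole]

open Classical in
lemma dcount (A B : Finset V) (p : V → V → Prop) :
    ∑ a ∈ A, ((B.filter (p a)).card : ℝ) = ∑ b ∈ B, ((A.filter (fun a => p a b)).card : ℝ) := by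
  simp only [cnt]
  rw [Finset.sum_comm]

open Classical in
/-- If many elements on average then many popular elements. -/
lemma popular (A B : Finset V) (p : V → V → Prop) {s m : ℝ} (hs : 0 ≤ s)
    (h : (s + m) * B.card ≤ ∑ b ∈ B, ((A.filter (fun a => p a b)).card : ℝ)) :
    m * B.card ≤ ∑ b ∈ B.filter (fun b => s ≤ (A.filter (fun a => p a b)).card),
      ((A.filter (fun a => p a b)).card : ℝ) := by
  rw [← Finset.sum_filter_add_sum_filter_not B
    (fun b => s ≤ ((A.filter (fun a => p a b)).card : ℝ))] at h
  have h2 : ∑ b ∈ B.filter (fun b => ¬ s ≤ ((A.filter (fun a => p a b)).card : ℝ)),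
      ((A.filter (fun a => p a b)).card : ℝ) ≤ s * B.card := by
    calc _ ≤ ∑ b ∈ B.filter (fun b => ¬ s ≤ ((A.filter (fun a => p a b)).card : ℝ)), s := by
          apply Finset.sum_le_sum
          intro b hb
          exact (not_le.1 (Finset.mem_filter.1 hb).2).le
      _ = (B.filter (fun b => ¬ s ≤ ((A.filter (fun a => p a b)).card : ℝ))).card * s := by
          rw [Finset.sum_const, nsmul_eq_mul]
      _ ≤ B.card * s := by
          gcongr
          apply Finset.filter_subset
      _ = _ := mul_comm _ _
  linarith

open Classical in
lemma paths3 {c : ℝ} (hc : 0 < c) : ∃ c'' : ℝ, 0 < c'' ∧ ∀ (A : Finset V) (r : V → V → Prop),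
    (∀ a b, r a b → r b a) → 0 < A.card →
    c * (A.card : ℝ) ^ 2 ≤ ∑ a ∈ A, ((A.filter (r a)).card : ℝ) →
    ∃ A' ⊆ A, ∃ B' ⊆ A, c / 6 * A.card ≤ A'.card ∧ c / 4 * A.card ≤ B'.card ∧
      ∀ a ∈ A', ∀ b ∈ B', c'' * (A.card : ℝ) ^ 2 ≤
        ((A ×ˢ A).filter (fun q => r a q.2 ∧ r q.1 q.2 ∧ r q.1 b)).card := by
  obtain ⟨γ, hγ⟩ : ∃ γ : ℝ, γ = c / 16 * (c ^ 2 / 8) := ⟨_, rfl⟩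
  have hγ0 : 0 < γ := by rw [hγ]; positivity
  refine ⟨c / 8 * (c / 3) * γ, by positivity, ?_⟩
  intro A r hsymm hA hE
  obtain ⟨n, hn⟩ : ∃ n : ℝ, n = A.card := ⟨_, rfl⟩
  have hn0 : 0 < n := by rw [hn]; exact_mod_cast hA
  rw [← hn] at hE ⊢
  let deg : V → ℝ := fun a => ((A.filter (r a)).card : ℝ)
  -- high degree vertices
  let A0 := A.filter (fun a => c / 2 * n ≤ deg a)
  have hA0 : c / 2 * n ^ 2 ≤ ∑ a ∈ A0, deg a := by
    have := popular A A (fun x y => r y x) (s := c / 2 * n) (m := c / 2 * n) (by positivity)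
      (by rw [← hn]; refine le_trans (le_of_eq (by ring)) hE)
    rw [← hn] at this
    refine le_trans (le_of_eq (by ring)) this
  have hA0deg : ∀ a ∈ A0, c / 2 * n ≤ deg a := fun a ha => (Finset.mem_filter.1 ha).2
  have hA0A : A0 ⊆ A := Finset.filter_subset _ _
  let N0 : V → Finset V := fun b => A0.filter (fun a => r a b)
  have hN0sum : c / 2 * n ^ 2 ≤ ∑ b ∈ A, ((N0 b).card : ℝ) := by
    refine hA0.trans (le_of_eq ?_)
    exact dcount A0 A r
  have hN0sq : c ^ 2 / 4 * n ^ 3 ≤ ∑ b ∈ A, ((N0 b).card : ℝ) ^ 2 := by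
    have hcs := sq_sum_le_card_mul_sum_sq (s := A) (f := fun b => ((N0 b).card : ℝ))
    rw [← hn] at hcs
    have h2 : (c / 2 * n ^ 2) ^ 2 ≤ (∑ b ∈ A, ((N0 b).card : ℝ)) ^ 2 :=
      pow_le_pow_left₀ (by positivity) hN0sum 2
    have h3 : n * (c ^ 2 / 4 * n ^ 3) ≤ n * ∑ b ∈ A, ((N0 b).card : ℝ) ^ 2 := by
      refine le_trans (le_of_eq (by ring)) (h2.trans hcs)
    exact le_of_mul_le_mul_left h3 hn0
  let bad : V → V → Prop := fun a a' => ((A.filter (fun b => r a b ∧ r a' b)).card : ℝ) < γ * n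
  have hbad : ∑ b ∈ A, (∑ a ∈ N0 b, (((N0 b).filter (bad a)).card : ℝ)) ≤ γ * n ^ 3 := by
    have e1 : ∀ b ∈ A, (∑ a ∈ N0 b, (((N0 b).filter (bad a)).card : ℝ)) =
        ∑ a ∈ A0, ∑ a' ∈ A0, if r a b ∧ r a' b ∧ bad a a' then (1:ℝ) else 0 := by
      intro b _
      simp only [N0, cnt, Finset.sum_filter]
      apply Finset.sum_congr rfl
      intro a _
      by_cases h : r a b
      · simp only [h, true_and, if_true]
        apply Finset.sum_congr rfl
        intro a' _
        by_cases h' : r a' b <;> simp [h']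
      · simp [h]
    rw [Finset.sum_congr rfl e1, Finset.sum_comm]
    have e2 : ∀ a ∈ A0, (∑ b ∈ A, ∑ a' ∈ A0, if r a b ∧ r a' b ∧ bad a a' then (1:ℝ) else 0) ≤
        n * (γ * n) := by
      intro a _
      rw [Finset.sum_comm]
      calc _ ≤ ∑ a' ∈ A0, γ * n := by
            apply Finset.sum_le_sum
            intro a' _
            by_cases h : bad a a'
            · simp only [h, and_true]
              refine le_trans (le_of_eq ?_) (le_of_lt h)
              rw [Finset.sum_boole]
            · simp only [h, and_false, if_false, Finset.sum_const_zero]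
              positivity
        _ = A0.card * (γ * n) := by rw [Finset.sum_const, nsmul_eq_mul]
        _ ≤ n * (γ * n) := by
            rw [hn]; gcongr
    calc _ ≤ ∑ a ∈ A0, n * (γ * n) := Finset.sum_le_sum e2
      _ = A0.card * (n * (γ * n)) := by rw [Finset.sum_const, nsmul_eq_mul]
      _ ≤ n * (n * (γ * n)) := by
          have : (A0.card : ℝ) ≤ n := by rw [hn]; exact_mod_cast Finset.card_le_card hA0A
          gcongr
      _ = _ := by ring
  obtain ⟨b0, hb0A, hb0⟩ : ∃ b0 ∈ A, c ^ 2 / 8 * n ^ 2 + (16 / c) *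
      (∑ a ∈ N0 b0, (((N0 b0).filter (bad a)).card : ℝ)) ≤ ((N0 b0).card : ℝ) ^ 2 := by
    apply Finset.exists_le_of_sum_le (Finset.card_pos.1 hA)
    rw [Finset.sum_add_distrib, Finset.sum_const, nsmul_eq_mul, ← hn]
    have h1 : (16 / c) * ∑ b ∈ A, (∑ a ∈ N0 b, (((N0 b).filter (bad a)).card : ℝ)) ≤
      (16 / c) * (γ * n ^ 3) := by gcongr
    have h2 : (16 / c) * (γ * n ^ 3) = c ^ 2 / 8 * n ^ 3 := by
      rw [hγ]; field_simp
    rw [Finset.mul_sum] at h1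
    nlinarith
  obtain ⟨A1, hA1⟩ : ∃ A1, A1 = N0 b0 := ⟨_, rfl⟩
  rw [← hA1] at hb0
  have hA1A0 : A1 ⊆ A0 := by rw [hA1]; exact Finset.filter_subset _ _
  have hbadnn : 0 ≤ ∑ a ∈ A1, ((A1.filter (bad a)).card : ℝ) :=
    Finset.sum_nonneg fun _ _ => Nat.cast_nonneg _
  obtain ⟨m, hm⟩ : ∃ m : ℝ, m = A1.card := ⟨_, rfl⟩
  rw [← hm] at hb0
  have hm0' : 0 ≤ m := by rw [hm]; positivity
  have hmn : c / 3 * n ≤ m := by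
    refine le_of_sq_le_sq ?_ hm0'
    have : 0 ≤ (16 / c) * ∑ a ∈ A1, ((A1.filter (bad a)).card : ℝ) := by positivity
    have h3 : 0 ≤ c ^ 2 * n ^ 2 := by positivity
    nlinarith
  have hm0 : 0 < m := lt_of_lt_of_le (by positivity) hmn
  have hbad1 : ∑ a ∈ A1, ((A1.filter (bad a)).card : ℝ) ≤ c / 16 * m ^ 2 := by
    have h3 : (16 / c) * (∑ a ∈ A1, ((A1.filter (bad a)).card : ℝ)) ≤ m ^ 2 := by
      have : 0 ≤ c ^ 2 / 8 * n ^ 2 := by positivity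
      linarith
    calc _ = c / 16 * ((16 / c) * (∑ a ∈ A1, ((A1.filter (bad a)).card : ℝ))) := by
          field_simp
      _ ≤ _ := by gcongr
  let A2 := A1.filter (fun a => ((A1.filter (bad a)).card : ℝ) ≤ c / 8 * m)
  have hA2A1 : A2 ⊆ A1 := Finset.filter_subset _ _
  have hA2 : m / 2 ≤ A2.card := by
    have h1 : ((A1.filter (fun a => ¬ ((A1.filter (bad a)).card : ℝ) ≤ c / 8 * m)).card : ℝ) *
        (c / 8 * m) ≤ c / 16 * m ^ 2 := by
      refine le_trans ?_ hbad1
      rw [← nsmul_eq_mul, ← Finset.sum_const]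
      refine le_trans (Finset.sum_le_sum (fun a ha => ?_)) (Finset.sum_le_sum_of_subset_of_nonneg
        (Finset.filter_subset (fun a => ¬ ((A1.filter (bad a)).card : ℝ) ≤ c / 8 * m) A1)
        (fun _ _ _ => Nat.cast_nonneg _))
      exact (not_le.1 (Finset.mem_filter.1 ha).2).le
    have h2 : ((A1.filter (fun a => ¬ ((A1.filter (bad a)).card : ℝ) ≤ c / 8 * m)).card : ℝ) ≤
        m / 2 := by
      refine le_of_mul_le_mul_right (h1.trans (le_of_eq (by ring))) (show 0 < c / 8 * m by positivity)
    have h3 : (A2.card : ℝ) + ((A1.filter (fun a => ¬ ((A1.filter (bad a)).card : ℝ) ≤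
        c / 8 * m)).card : ℝ) = m := by
      have := Finset.card_filter_add_card_filter_not (s := A1)
        (fun a => ((A1.filter (bad a)).card : ℝ) ≤ c / 8 * m)
      rw [hm] at this ⊢
      simp only [A2, hm]
      exact_mod_cast this
    linarith
  let B2 := A.filter (fun b => c / 4 * m ≤ (A1.filter (fun a => r a b)).card)
  have hB2 : c / 4 * n ≤ B2.card := by
    have h1 : (c / 4 * m + c / 4 * m) * (A.card : ℝ) ≤
        ∑ b ∈ A, ((A1.filter (fun a => r a b)).card : ℝ) := by
      rw [← dcount A1 A r]
      calc _ = ∑ a ∈ A1, c / 2 * n := by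
            rw [Finset.sum_const, nsmul_eq_mul, ← hm, ← hn]; ring
        _ ≤ _ := Finset.sum_le_sum fun a ha => hA0deg a (hA1A0 ha)
    have h2 := popular A1 A r (by positivity) h1
    have h3 : ∑ b ∈ B2, ((A1.filter (fun a => r a b)).card : ℝ) ≤ B2.card * m := by
      rw [← nsmul_eq_mul, ← Finset.sum_const]
      apply Finset.sum_le_sum
      intro b _
      rw [hm]
      exact_mod_cast Finset.card_filter_le _ _
    rw [← hn] at h2
    have h4 : (c / 4 * n) * m ≤ B2.card * m := le_trans (le_of_eq (by ring)) (h2.trans h3)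
    exact le_of_mul_le_mul_right h4 hm0
  refine ⟨A2, hA2A1.trans (hA1A0.trans hA0A), B2, Finset.filter_subset _ _, by linarith, hB2, ?_⟩
  intro a ha b hb
  have ha' := (Finset.mem_filter.1 ha).2
  have hb' := (Finset.mem_filter.1 hb).2
  let G := (A1.filter (fun a1 => r a1 b)).filter (fun a1 => ¬ bad a a1)
  have hG : c / 8 * m ≤ G.card := by
    have h1 := Finset.card_filter_add_card_filter_not (s := A1.filter (fun a1 => r a1 b)) (bad a)
    have h2 : (((A1.filter (fun a1 => r a1 b)).filter (bad a)).card : ℝ) ≤ c / 8 * m := by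
      refine le_trans ?_ ha'
      exact_mod_cast Finset.card_le_card (Finset.filter_subset_filter _ (Finset.filter_subset _ _))
    have h3 : (((A1.filter (fun a1 => r a1 b)).filter (bad a)).card : ℝ) + G.card =
      (A1.filter (fun a1 => r a1 b)).card := by exact_mod_cast h1
    linarith
  have hsub : (G.sigma (fun a1 => A.filter (fun b1 => r a b1 ∧ r a1 b1))).card ≤
      ((A ×ˢ A).filter (fun q => r a q.2 ∧ r q.1 q.2 ∧ r q.1 b)).card := by
    apply Finset.card_le_card_of_injOn (fun s => (s.1, s.2))
    · rintro ⟨a1, b1⟩ hs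
      simp only [Finset.mem_coe, Finset.mem_sigma, Finset.mem_filter, G] at hs
      simp only [Finset.mem_coe, Finset.mem_filter, Finset.mem_product]
      exact ⟨⟨hA0A (hA1A0 hs.1.1.1), hs.2.1⟩, hs.2.2.1, hs.2.2.2, hs.1.1.2⟩
    · rintro ⟨a1, b1⟩ _ ⟨a2, b2⟩ _ h
      simp only [Prod.mk.injEq] at h
      obtain ⟨rfl, rfl⟩ := h
      rfl
  have hsub' : ((G.sigma (fun a1 => A.filter (fun b1 => r a b1 ∧ r a1 b1))).card : ℝ) ≤
      ((A ×ˢ A).filter (fun q => r a q.2 ∧ r q.1 q.2 ∧ r q.1 b)).card := by exact_mod_cast hsub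
  refine le_trans ?_ hsub'
  rw [Finset.card_sigma, Nat.cast_sum]
  calc c / 8 * (c / 3) * γ * n ^ 2 = (c / 8 * (c / 3 * n)) * (γ * n) := by ring
    _ ≤ (c / 8 * m) * (γ * n) := by gcongr
    _ ≤ G.card * (γ * n) := by gcongr
    _ = ∑ a1 ∈ G, γ * n := by rw [Finset.sum_const, nsmul_eq_mul]
    _ ≤ _ := by
      apply Finset.sum_le_sum
      intro a1 h1
      exact not_lt.1 (Finset.mem_filter.1 h1).2

end bsg

open scoped Pointwise in
lemma bsg (c K : ℝ) (hc : 0 < c) (hK : 0 < K) : ∃ c' : ℝ, 0 < c' ∧ ∃ K' : ℝ, 0 < K' ∧ ∀ (A : Finset ℝ)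
    (E : Finset (ℝ × ℝ)), 0 < A.card → (∀ p ∈ E, p.1 ∈ A ∧ p.2 ∈ A) →
      (∀ p ∈ E, (p.2, p.1) ∈ E) →
      c * (A.card : ℝ) ^ 2 ≤ (E.card : ℝ) →
      ((E.image (fun p => p.1 + p.2)).card : ℝ) ≤ K * (A.card : ℝ) →
      ∃ A' ⊆ A, ∃ B' ⊆ A, c' * A.card ≤ A'.card ∧ c' * A.card ≤ B'.card ∧
        ((A' + B').card : ℝ) ≤ K' * A.card := by
  classical
  obtain ⟨c'', hc'', hp⟩ := paths3 (V := ℝ) hc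
  refine ⟨c / 6, by positivity, K ^ 3 / c'', by positivity, ?_⟩
  intro A E hA hEA hsymm hE hS
  have hcount : (E.card : ℝ) = ∑ a ∈ A, ((A.filter (fun b => (a, b) ∈ E)).card : ℝ) := by
    have h1 : E = (A ×ˢ A).filter (fun p => (p.1, p.2) ∈ E) := by
      ext p
      simp only [Finset.mem_filter, Finset.mem_product]
      exact ⟨fun h => ⟨hEA p h, h⟩, fun h => h.2⟩
    conv_lhs => rw [h1]
    rw [← Finset.sum_boole, Finset.sum_product]
    simp only [Finset.sum_boole]
  obtain ⟨A', hA', B', hB', h1, h2, h3⟩ := hp A (fun a b => (a, b) ∈ E) (fun a b h => hsymm _ h) hA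
    (by convert hE.trans_eq hcount)
  refine ⟨A', hA', B', hB', h1, le_trans (by gcongr; norm_num) h2, ?_⟩
  obtain ⟨S, hSdef⟩ : ∃ S, S = E.image (fun p => p.1 + p.2) := ⟨_, rfl⟩
  rw [← hSdef] at hS
  have hSmem : ∀ a b, (a, b) ∈ E → a + b ∈ S := by
    intro a b h
    rw [hSdef]
    exact Finset.mem_image.2 ⟨(a, b), h, rfl⟩
  obtain ⟨n, hn⟩ : ∃ n : ℝ, n = A.card := ⟨_, rfl⟩
  have hn0 : 0 < n := by rw [hn]; exact_mod_cast hA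
  rw [← hn] at hS h3 ⊢
  have hfib : ∀ z ∈ A' + B', c'' * n ^ 2 ≤
      (((S ×ˢ S ×ˢ S).filter (fun s => s.1 - s.2.1 + s.2.2 = z)).card : ℝ) := by
    intro z hz
    obtain ⟨a, ha, b, hb, rfl⟩ := Finset.mem_add.1 hz
    refine (h3 a ha b hb).trans ?_
    norm_cast
    apply Finset.card_le_card_of_injOn (fun q => (a + q.2, q.1 + q.2, q.1 + b))
    · rintro ⟨a1, b1⟩ hq
      simp only [Finset.mem_coe, Finset.mem_filter, Finset.mem_product] at hq ⊢
      exact ⟨⟨hSmem _ _ hq.2.1, hSmem _ _ hq.2.2.1, hSmem _ _ hq.2.2.2⟩, by ring⟩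
    · rintro ⟨a1, b1⟩ _ ⟨a2, b2⟩ _ h
      simp only [Prod.mk.injEq, add_right_inj, add_left_inj] at h ⊢
      exact ⟨h.2.2, h.1⟩
  have hsum : ((A' + B').card : ℝ) * (c'' * n ^ 2) ≤ (K * n) ^ 3 := by
    calc _ = ∑ z ∈ A' + B', c'' * n ^ 2 := by rw [Finset.sum_const, nsmul_eq_mul]
      _ ≤ ∑ z ∈ A' + B', (((S ×ˢ S ×ˢ S).filter (fun s => s.1 - s.2.1 + s.2.2 = z)).card : ℝ) :=
          Finset.sum_le_sum hfib
      _ ≤ ((S ×ˢ S ×ˢ S).card : ℝ) := by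
          norm_cast
          rw [Finset.sum_card_fiberwise_eq_card_filter]
          exact Finset.card_filter_le _ _
      _ = (S.card : ℝ) ^ 3 := by
          rw [Finset.card_product, Finset.card_product]; push_cast; ring
      _ ≤ _ := by gcongr
  have : ((A' + B').card : ℝ) * (c'' * n ^ 2) ≤ (K ^ 3 / c'' * n) * (c'' * n ^ 2) := by
    refine hsum.trans (le_of_eq ?_)
    field_simp
  exact le_of_mul_le_mul_right this (by positivity)

end DHJ

namespace DHJ
open Combinatorics

open scoped Pointwise
open Classical in
/-- popular difference -/
lemma pop_diff (A B : Finset ℝ) {t u : ℝ} (hu : 0 ≤ u)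
    (h : ∀ d, d ≠ 0 → ((A.filter (fun a => a - d ∈ A)).card : ℝ) ≤ u) :
    (A.card : ℝ) ^ 2 * B.card ^ 2 ≤ (A + B).card * (A.card * B.card + B.card ^ 2 * u) := by
  have h1 := Finset.le_card_add_mul_addEnergy A B
  have h1' : (A.card : ℝ) ^ 2 * B.card ^ 2 ≤ (A + B).card * (Finset.addEnergy A B : ℝ) := by
    exact_mod_cast h1
  refine h1'.trans ?_
  gcongr
  have hsub : Finset.addEnergy A B ≤
      ((B ×ˢ B).sigma (fun b => A.filter (fun a => a - (b.2 - b.1) ∈ A))).card := by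
    rw [Finset.addEnergy]
    apply Finset.card_le_card_of_injOn (fun x => ⟨x.2, x.1.1⟩)
    · rintro ⟨⟨a1, a2⟩, b1, b2⟩ hx
      simp only [Finset.mem_coe, Finset.mem_filter, Finset.mem_product, Finset.mem_sigma] at hx ⊢
      refine ⟨hx.1.2, hx.1.1.1, ?_⟩
      rw [show a1 - (b2 - b1) = a2 by linarith [hx.2]]
      exact hx.1.1.2
    · rintro ⟨⟨a1, a2⟩, b1, b2⟩ hx ⟨⟨a1', a2'⟩, b1', b2'⟩ hx' heq
      simp only [Finset.mem_coe, Finset.mem_filter, Finset.mem_product] at hx hx'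
      simp only [Sigma.mk.injEq, Prod.mk.injEq, heq_eq_eq] at heq
      obtain ⟨⟨rfl, rfl⟩, rfl⟩ := heq
      have : a2 = a2' := by linarith [hx.2, hx'.2]
      rw [this]
  have hsub' : (Finset.addEnergy A B : ℝ) ≤
      (((B ×ˢ B).sigma (fun b => A.filter (fun a => a - (b.2 - b.1) ∈ A))).card : ℝ) := by
    exact_mod_cast hsub
  refine hsub'.trans ?_
  rw [Finset.card_sigma, Nat.cast_sum]
  calc _ ≤ ∑ b ∈ B ×ˢ B, ((if b.1 = b.2 then (A.card : ℝ) else 0) + u) := by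
        apply Finset.sum_le_sum
        rintro ⟨b1, b2⟩ _
        by_cases hb : b1 = b2
        · simp only [hb, if_true]
          have : ((A.filter (fun a => a - (b2 - b2) ∈ A)).card : ℝ) ≤ A.card := by
            exact_mod_cast Finset.card_filter_le _ _
          linarith
        · simp only [hb, if_false, zero_add]
          exact h _ (fun h0 => hb (by linarith))
    _ = _ := by
        rw [Finset.sum_add_distrib, Finset.sum_product, Finset.sum_const, nsmul_eq_mul,
          Finset.card_product]
        have : ∀ x ∈ B, ∑ y ∈ B, (if x = y then (A.card : ℝ) else 0) = A.card := by
          intro x hx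
          rw [Finset.sum_ite_eq]; simp [hx]
        rw [Finset.sum_congr rfl this, Finset.sum_const, nsmul_eq_mul]
        push_cast
        ring

open Classical in
lemma almost_aux (c K ε : ℝ) (hc : 0 < c) (hK : 0 < K) (hε : 0 < ε) (hε1 : ε < 1) (r : ℕ) :
    ∀ t : ℝ, 0 < t → ∃ n0 : ℕ, ∀ n : ℕ, n0 ≤ n → ∀ A B : Finset ℝ, t * n ≤ A.card → c * n ≤ B.card →
      ((A + B).card : ℝ) ≤ K * n → ((A + B).card : ℝ) * (1 - ε) ^ r < c * n →
      ∃ A' ⊆ A, A'.Nonempty ∧ ∃ d : ℝ, d ≠ 0 ∧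
        (((A' + B).filter (fun y => y - d ∉ A' + B)).card : ℝ) ≤ ε * (A' + B).card := by
  induction r with
  | zero =>
    intro t ht
    refine ⟨1, fun n hn A B hA hB hAB hr => ?_⟩
    exfalso
    have hn' : (0:ℝ) < n := by exact_mod_cast hn
    have hAne : A.Nonempty := by
      rw [← Finset.card_pos]
      have : (0:ℝ) < A.card := lt_of_lt_of_le (by positivity) hA
      exact_mod_cast this
    have : (B.card : ℝ) ≤ (A + B).card := by
      exact_mod_cast Finset.card_le_card_add_left hAne
    simp at hr
    linarith
  | succ r ih =>
    intro t ht
    obtain ⟨n1, hn1⟩ := ih (t ^ 2 / (2 * K)) (by positivity)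
    obtain ⟨n2, hn2⟩ := exists_nat_gt (2 * K / (t * c))
    refine ⟨max n1 (n2 + 1), fun n hn A B hA hB hAB hr => ?_⟩
    have hnn1 : n1 ≤ n := (le_max_left _ _).trans hn
    have hnn2 : n2 + 1 ≤ n := (le_max_right _ _).trans hn
    have hnn2' : (n2:ℝ) < n := by exact_mod_cast hnn2
    have hnpos : (0:ℝ) < n := lt_of_le_of_lt (Nat.cast_nonneg n2) hnn2'
    have hbig : 2 * K < t * c * n := by
      have := hn2.trans hnn2'
      rw [div_lt_iff₀ (by positivity)] at this
      linarith
    obtain ⟨d, hd, hd2⟩ : ∃ d : ℝ, d ≠ 0 ∧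
        t ^ 2 / (2 * K) * n < ((A.filter (fun a => a - d ∈ A)).card : ℝ) := by
      by_contra hcon
      push Not at hcon
      have h1 := pop_diff A B (t := t) (u := t ^ 2 / (2 * K) * n) (by positivity) hcon
      have ha0 : (0:ℝ) < A.card := lt_of_lt_of_le (by positivity) hA
      have hb0 : (0:ℝ) < B.card := lt_of_lt_of_le (by positivity) hB
      generalize (A.card : ℝ) = a at *
      generalize (B.card : ℝ) = b at *
      have h2 : a ^ 2 * b ^ 2 ≤ (K * n) * (a * b + b ^ 2 * (t ^ 2 / (2 * K) * n)) := by
        refine h1.trans ?_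
        gcongr
      have h3 : (K * n) * (a * b + b ^ 2 * (t ^ 2 / (2 * K) * n)) =
          K * n * a * b + b ^ 2 * (t * n) ^ 2 / 2 := by field_simp
      have h4 : b ^ 2 * (t * n) ^ 2 ≤ b ^ 2 * a ^ 2 := by gcongr
      have h5 : a * b * (a * b) ≤ (2 * K * n) * (a * b) := by nlinarith
      have h6 := le_of_mul_le_mul_right h5 (by positivity)
      have h7 : (t * n) * (c * n) ≤ a * b := by gcongr
      have h8 : (t * c * n) * n ≤ (2 * K) * n := by nlinarith
      have h9 := le_of_mul_le_mul_right h8 hnpos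
      linarith
    have hAne : A.Nonempty := by
      rw [← Finset.card_pos]
      have : (0:ℝ) < A.card := lt_of_lt_of_le (by positivity) hA
      exact_mod_cast this
    by_cases hgood : (((A + B).filter (fun y => y - d ∉ A + B)).card : ℝ) ≤ ε * (A + B).card
    · exact ⟨A, Finset.Subset.refl _, hAne, d, hd, hgood⟩
    · push Not at hgood
      let A1 := A.filter (fun a => a - d ∈ A)
      have hA1 : A1 ⊆ A := Finset.filter_subset _ _
      have hsub : A1 + B ⊆ (A + B).filter (fun y => ¬ (y - d ∉ A + B)) := by
        intro z hz
        obtain ⟨a, ha, b, hb, rfl⟩ := Finset.mem_add.1 hz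
        rw [Finset.mem_filter, not_not]
        have ha' := Finset.mem_filter.1 ha
        refine ⟨Finset.add_mem_add ha'.1 hb, ?_⟩
        rw [show a + b - d = (a - d) + b by ring]
        exact Finset.add_mem_add ha'.2 hb
      have hc1 : ((A1 + B).card : ℝ) ≤ (1 - ε) * (A + B).card := by
        have e1 := Finset.card_filter_add_card_filter_not (s := A + B) (fun y => y - d ∉ A + B)
        have e2 : ((A1 + B).card : ℝ) ≤ ((A + B).filter (fun y => ¬ (y - d ∉ A + B))).card := by
          exact_mod_cast Finset.card_le_card hsub
        have e3 : (((A + B).filter (fun y => y - d ∉ A + B)).card : ℝ) +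
          ((A + B).filter (fun y => ¬ (y - d ∉ A + B))).card = (A + B).card := by exact_mod_cast e1
        linarith
      have hle : ((A1 + B).card : ℝ) ≤ (A + B).card := by
        exact_mod_cast Finset.card_le_card (Finset.add_subset_add_right hA1)
      obtain ⟨A', hA', hne, d', hd', h'⟩ := hn1 n hnn1 A1 B hd2.le hB (hle.trans hAB) (by
        refine lt_of_le_of_lt ?_ hr
        rw [pow_succ, ← mul_assoc, mul_right_comm]
        rw [mul_comm (_ : ℝ) (1 - ε)]
        have : 0 ≤ (1 - ε) ^ r := by
          apply pow_nonneg; linarith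
        have := mul_le_mul_of_nonneg_right hc1 this
        linarith)
      exact ⟨A', hA'.trans hA1, hne, d', hd', h'⟩

open Classical in
lemma iter_period (C : Finset ℝ) (d ε : ℝ)
    (h : ((C.filter (fun y => y - d ∉ C)).card : ℝ) ≤ ε * C.card) (j : ℕ) :
    ((C.filter (fun y => y - j * d ∉ C)).card : ℝ) ≤ j * (ε * C.card) := by
  induction j with
  | zero => simp
  | succ j ih =>
    have hsub : C.filter (fun y => y - (j + 1 : ℕ) * d ∉ C) ⊆ C.filter (fun y => y - j * d ∉ C) ∪
        (C.filter (fun y => y - d ∉ C)).image (fun y => y + j * d) := by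
      intro y hy
      rw [Finset.mem_filter] at hy
      rw [Finset.mem_union]
      by_cases h1 : y - j * d ∈ C
      · right
        refine Finset.mem_image.2 ⟨y - j * d, Finset.mem_filter.2 ⟨h1, ?_⟩, by ring⟩
        convert hy.2 using 2
        push_cast; ring
      · left
        exact Finset.mem_filter.2 ⟨hy.1, h1⟩
    have h2 := (Finset.card_le_card hsub).trans (Finset.card_union_le _ _)
    have h3 := h2.trans (Nat.add_le_add_left Finset.card_image_le _)
    have h4 : ((C.filter (fun y => y - (j + 1 : ℕ) * d ∉ C)).card : ℝ) ≤
      (C.filter (fun y => y - j * d ∉ C)).card + (C.filter (fun y => y - d ∉ C)).card := by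
      exact_mod_cast h3
    refine h4.trans ?_
    push_cast
    linarith

lemma line_ap {ι : Type} [Fintype ι] (k : ℕ) (V : Subspace Unit (Fin (k + 1)) ι) :
    ∃ s m : ℕ, 0 < m ∧ ∀ j : Fin (k + 1), ∑ i, (V (fun _ => j) i : ℕ) = s + j * m := by
  classical
  refine ⟨∑ i, (V.idxFun i).elim (fun a : Fin (k + 1) => (a : ℕ)) (fun _ => 0),
    ∑ i, (V.idxFun i).elim (fun _ => 0) (fun _ => 1), ?_, ?_⟩
  · obtain ⟨i, hi⟩ := V.proper ()
    refine Finset.sum_pos' (fun _ _ => Nat.zero_le _) ⟨i, Finset.mem_univ _, ?_⟩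
    simp [hi]
  · intro j
    rw [Finset.mul_sum, ← Finset.sum_add_distrib]
    apply Finset.sum_congr rfl
    intro i _
    rw [Subspace.coe_apply]
    rcases V.idxFun i with a | u <;> simp

lemma D_finset (C : Finset ℝ) (p : ℝ → Prop) [DecidablePred p] :
    D {y : C | p y} = ((C.filter p).card : ℝ) / C.card := by
  rw [D, avg_eq, Fintype.card_coe]
  congr 1
  rw [← Finset.sum_boole, ← Finset.sum_coe_sort C]
  apply Finset.sum_congr rfl
  intro y _
  by_cases h : p y <;> simp [h]

open Classical in
lemma ap_of_period (k : ℕ) (δ : ℝ) (hδ : 0 < δ) : ∃ ε : ℝ, 0 < ε ∧ ε < 1 ∧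
    ∀ (C B : Finset ℝ) (d : ℝ), d ≠ 0 → B ⊆ C → C.Nonempty → δ * C.card ≤ B.card →
      ((C.filter (fun y => y - d ∉ C)).card : ℝ) ≤ ε * C.card →
      ∃ x e : ℝ, e ≠ 0 ∧ ∀ i : ℕ, i ≤ k → x + i * e ∈ B := by
  obtain ⟨ι, hι, hg⟩ := dhj k (δ / 2) (by positivity)
  have := Fintype.ofFinite ι
  obtain ⟨L, hL⟩ : ∃ L : ℕ, L = Fintype.card ι * k := ⟨_, rfl⟩
  refine ⟨min (1 / 2) (δ / (2 * (L + 1))), by positivity,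
    lt_of_le_of_lt (min_le_left _ _) (by norm_num), ?_⟩
  intro C B d hd hBC hC hδB hper
  have hC0 : (0:ℝ) < C.card := by exact_mod_cast hC.card_pos
  let s : (ι → Fin (k + 1)) → ℕ := fun v => ∑ i, (v i : ℕ)
  have hs : ∀ v, s v ≤ L := by
    intro v
    rw [hL, ← smul_eq_mul, ← Finset.card_univ, ← Finset.sum_const]
    exact Finset.sum_le_sum fun i _ => Nat.lt_succ_iff.1 (v i).2
  have hdens : ∀ v, δ / 2 ≤ D {y : C | (y : ℝ) + s v * d ∈ B} := by
    intro v
    rw [D_finset C (fun y => y + s v * d ∈ B), le_div_iff₀ hC0]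
    have hsub : B ⊆ (C.filter (fun y => y - (s v : ℝ) * d ∉ C)) ∪
        (C.filter (fun y => y + s v * d ∈ B)).image (fun y => y + s v * d) := by
      intro b hb
      rw [Finset.mem_union]
      by_cases h1 : b - s v * d ∈ C
      · right
        refine Finset.mem_image.2 ⟨b - s v * d, Finset.mem_filter.2 ⟨h1, ?_⟩, by ring⟩
        simpa using hb
      · left
        exact Finset.mem_filter.2 ⟨hBC hb, h1⟩
    have h2 := (Finset.card_le_card hsub).trans (Finset.card_union_le _ _)
    have h3 := h2.trans (Nat.add_le_add_left Finset.card_image_le _)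
    have h4 : (B.card : ℝ) ≤ (C.filter (fun y => y - (s v : ℝ) * d ∉ C)).card +
      (C.filter (fun y => y + s v * d ∈ B)).card := by exact_mod_cast h3
    have h5 := iter_period C d _ hper (s v)
    have h6 : (s v : ℝ) * (min (1 / 2) (δ / (2 * (L + 1))) * C.card) ≤ δ / 2 * C.card := by
      have e1 : (s v : ℝ) ≤ L + 1 := by
        have : (s v : ℝ) ≤ L := by exact_mod_cast hs v
        linarith
      calc _ ≤ ((L:ℝ) + 1) * (δ / (2 * (L + 1)) * C.card) := by
            gcongr
            exact min_le_right _ _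
        _ = _ := by field_simp
    linarith
  have hCne : Nonempty C := hC.to_subtype
  have h1 : δ / 2 ≤ avg fun v => D {y : C | (y : ℝ) + s v * d ∈ B} := le_avg hdens
  rw [D_avg_comm] at h1
  obtain ⟨y, hy⟩ := exists_avg_le (fun y : C => D {v : ι → Fin (k + 1) |
    y ∈ {y : C | (y : ℝ) + s v * d ∈ B}})
  obtain ⟨V, hV⟩ := hg _ (h1.trans hy)
  obtain ⟨s0, m, hm, hsm⟩ := line_ap k V
  refine ⟨y + s0 * d, m * d, mul_ne_zero (by exact_mod_cast hm.ne') hd, fun i hi => ?_⟩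
  have h2 := hV (fun _ => ⟨i, Nat.lt_succ_iff.2 hi⟩)
  have h3 : s (V (fun _ => ⟨i, Nat.lt_succ_iff.2 hi⟩)) = s0 + i * m := hsm ⟨i, _⟩
  simp only [Set.mem_ofPred_eq, h3] at h2
  convert h2 using 1
  push_cast
  ring

lemma main (c K : ℝ) (hc : 0 < c) (hK : 0 < K) (k : ℕ) :
    ∃ n₀ : ℕ, ∀ (A : Finset ℝ) (E : Finset (ℝ × ℝ)),
      n₀ ≤ A.card →
      (∀ p ∈ E, p.1 ∈ A ∧ p.2 ∈ A) →
      (∀ p ∈ E, (p.2, p.1) ∈ E) →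
      c * (A.card : ℝ) ^ 2 ≤ (E.card : ℝ) →
      ((E.image (fun p => p.1 + p.2)).card : ℝ) ≤ K * (A.card : ℝ) →
      ∃ x d : ℝ, d ≠ 0 ∧ ∀ i : ℕ, i ≤ k → x + (i : ℝ) * d ∈ A := by
  classical
  obtain ⟨c', hc', K', hK', hbsg⟩ := bsg c K hc hK
  obtain ⟨ε, hε, hε1, hap⟩ := ap_of_period k (c' / K') (by positivity)
  obtain ⟨r, hr⟩ := exists_pow_lt_of_lt_one (show 0 < c' / K' by positivity)
    (show 1 - ε < 1 by linarith)
  obtain ⟨n0, hn0⟩ := almost_aux c' K' ε hc' hK' hε hε1 r c' hc'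
  refine ⟨max n0 1, fun A E hn hEA hsymm hE hS => ?_⟩
  have hA : 0 < A.card := lt_of_lt_of_le one_pos ((le_max_right _ _).trans hn)
  have hA' : (0:ℝ) < A.card := by exact_mod_cast hA
  obtain ⟨A', hA'A, B', hB'A, h1, h2, h3⟩ := hbsg A E hA hEA hsymm hE hS
  obtain ⟨A'', hA'', ⟨a, ha⟩, d, hd, hper⟩ := hn0 A.card ((le_max_left _ _).trans hn) A' B' h1 h2 h3 (by
    have hp : 0 ≤ (1 - ε) ^ r := pow_nonneg (by linarith) r
    calc _ ≤ (K' * A.card) * (1 - ε) ^ r := by gcongr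
      _ < (K' * A.card) * (c' / K') := by gcongr
      _ = _ := by field_simp)
  have hB'pos : (0:ℝ) < B'.card := lt_of_lt_of_le (by positivity) h2
  obtain ⟨b, hb⟩ : B'.Nonempty := by
    rw [← Finset.card_pos]; exact_mod_cast hB'pos
  obtain ⟨x, e, he, hx⟩ := hap (A'' + B') (B'.image (fun b => a + b)) d hd (by
      intro z hz
      obtain ⟨b, hb, rfl⟩ := Finset.mem_image.1 hz
      exact Finset.add_mem_add ha hb) ⟨a + b, Finset.add_mem_add ha hb⟩ (by
      rw [Finset.card_image_of_injective _ (add_right_injective a)]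
      have : ((A'' + B').card : ℝ) ≤ (A' + B').card := by
        exact_mod_cast Finset.card_le_card (Finset.add_subset_add_right hA'')
      calc _ ≤ c' / K' * (K' * A.card) := by
            gcongr
            exact this.trans h3
        _ = c' * A.card := by field_simp
        _ ≤ _ := h2) hper
  refine ⟨x - a, e, he, fun i hi => ?_⟩
  obtain ⟨b, hb, hab⟩ := Finset.mem_image.1 (hx i hi)
  rw [show x - a + i * e = b by linarith]
  exact hB'A hb

end DHJ

/-- For all real constants `c > 0`, `K > 0` and every integer `k ≥ 3` there is
a threshold `n₀ = n₀(c, K, k)` such that: if `A` is a finite set of reals with `|A| = n ≥ n₀`,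
and `G` is a graph on vertex set `A` (given by a symmetric edge set `E ⊆ A × A`) with at least
`c·n²` edges and `|A +_G A| ≤ K·|A|`, then `A` contains a `k`-term arithmetic progression. -/
theorem stmt_0 (c K : ℝ) (hc : 0 < c) (hK : 0 < K) (k : ℕ) (hk : 3 ≤ k) :
    ∃ n₀ : ℕ, ∀ (A : Finset ℝ) (E : Finset (ℝ × ℝ)),
      n₀ ≤ A.card →
      (∀ p ∈ E, p.1 ∈ A ∧ p.2 ∈ A) →
      (∀ p ∈ E, (p.2, p.1) ∈ E) →
      c * (A.card : ℝ) ^ 2 ≤ (E.card : ℝ) →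
      ((E.image (fun p => p.1 + p.2)).card : ℝ) ≤ K * (A.card : ℝ) →
      ∃ x d : ℝ, d ≠ 0 ∧ ∀ i : ℕ, i ≤ k - 1 → x + (i : ℝ) * d ∈ A := by
  obtain ⟨n₀, h⟩ := DHJ.main c K hc hK (k - 1)
  exact ⟨n₀, h⟩
end

section
/- For all real constants c > 0 and K > 0 there exist a threshold n₀ = n₀(c, K) and a constant δ > 0 depending only on c and K such that the following holds. Let A be a finite set of real numbers with |A| = n ≥ n₀, and let G be a graph with vertex set A such that G has at least c·n² edges and |A +_G A| ≤ K·|A|. Then A contains at least δ·n² three-term arithmetic progressions, i.e., there are at least δ·n² pairs (x, d) with d ≠ 0 such that x, x+d, x+2d all belong to A. -/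
set_option maxHeartbeats 2000000 in
open Finset in
lemma bsg_graph {α : Type*} (A : Finset α) (r : α → α → Prop) (c : ℝ) (hc : 0 < c)
    (hA : A.Nonempty) [∀ x y, Decidable (r x y)] [DecidableEq α]
    (hE : c * (#A : ℝ) ^ 2 ≤ ∑ x ∈ A, (#(A.filter (fun y => r x y)) : ℝ)) :
    ∃ X ⊆ A, ∃ Y ⊆ A, c / 6 * #A ≤ (#X : ℝ) ∧ c / 4 * #A ≤ (#Y : ℝ) ∧
      ∀ x ∈ X, ∀ y ∈ Y, c ^ 5 / 3072 * (#A : ℝ) ^ 2 ≤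
        (#((A ×ˢ A).filter (fun p => r x p.1 ∧ r p.2 p.1 ∧ r p.2 y)) : ℝ) := by
  have hn : (0:ℝ) < #A := by exact_mod_cast hA.card_pos
  set n : ℝ := (#A : ℝ) with hndef
  set deg : α → ℝ := fun x => (#(A.filter (fun y => r x y)) : ℝ) with hdeg
  set A0 := A.filter (fun x => c / 2 * n ≤ deg x) with hA0
  set N : α → Finset α := fun v => A0.filter (fun x => r x v) with hN
  set cod : α → α → ℝ := fun x y => (#(A.filter (fun v => r x v ∧ r y v)) : ℝ) with hcod
  set bad : α → Finset (α × α) := fun v =>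
    (N v ×ˢ N v).filter (fun p => cod p.1 p.2 < c ^ 3 / 128 * n) with hbad
  -- degrees
  have h1 : c / 2 * n ^ 2 ≤ ∑ v ∈ A, (#(N v) : ℝ) := by
    have e1 : ∑ v ∈ A, (#(N v) : ℝ) = ∑ x ∈ A0, deg x := by
      have := Finset.sum_card_bipartiteAbove_eq_sum_card_bipartiteBelow (s := A0) (t := A)
        (r := r)
      simp only [bipartiteAbove, bipartiteBelow] at this
      simp only [hN, hdeg]
      exact_mod_cast this.symm
    have e2 := Finset.sum_filter_add_sum_filter_not A (fun x => c / 2 * n ≤ deg x) deg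
    have e3 : ∑ x ∈ A.filter (fun x => ¬ c / 2 * n ≤ deg x), deg x ≤ n * (c / 2 * n) := by
      calc _ ≤ ∑ x ∈ A.filter (fun x => ¬ c / 2 * n ≤ deg x), c / 2 * n := by
            apply Finset.sum_le_sum
            intro x hx
            exact (not_le.1 (Finset.mem_filter.1 hx).2).le
        _ ≤ _ := by
            rw [Finset.sum_const, nsmul_eq_mul]
            refine mul_le_mul_of_nonneg_right ?_ (by positivity)
            exact Nat.cast_le.2 (Finset.card_le_card (Finset.filter_subset _ _))
    rw [e1]
    have : ∑ x ∈ A, deg x ≥ c * n ^ 2 := hE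
    rw [← hA0] at e2
    nlinarith
  have h2 : (c / 2 * n ^ 2) ^ 2 ≤ n * ∑ v ∈ A, (#(N v) : ℝ) ^ 2 := by
    have := sq_sum_le_card_mul_sum_sq (s := A) (f := fun v => (#(N v) : ℝ))
    refine le_trans ?_ this
    gcongr
  have h3 : ∑ v ∈ A, (#(bad v) : ℝ) ≤ c ^ 3 / 128 * n * n ^ 2 := by
    have := Finset.sum_card_bipartiteAbove_eq_sum_card_bipartiteBelow (s := A)
        (t := (A0 ×ˢ A0).filter (fun p => cod p.1 p.2 < c ^ 3 / 128 * n))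
        (r := fun v p => r p.1 v ∧ r p.2 v)
    simp only [bipartiteAbove, bipartiteBelow] at this
    have e1 : ∑ v ∈ A, (#(bad v) : ℝ) =
        ∑ p ∈ (A0 ×ˢ A0).filter (fun p => cod p.1 p.2 < c ^ 3 / 128 * n), cod p.1 p.2 := by
      simp only [hcod]
      rw [← Nat.cast_sum, ← Nat.cast_sum, ← this]
      congr 1
      apply Finset.sum_congr rfl
      intro v _
      congr 1
      ext p
      simp only [hbad, hN, Finset.mem_filter, Finset.mem_product]
      tauto
    rw [e1]
    calc _ ≤ ∑ p ∈ (A0 ×ˢ A0).filter (fun p => cod p.1 p.2 < c ^ 3 / 128 * n),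
              c ^ 3 / 128 * n := by
            apply Finset.sum_le_sum
            intro x hx
            exact (Finset.mem_filter.1 hx).2.le
      _ ≤ _ := by
        rw [Finset.sum_const, nsmul_eq_mul, mul_comm]
        gcongr
        have : #((A0 ×ˢ A0).filter (fun p => cod p.1 p.2 < c ^ 3 / 128 * n)) ≤ #A * #A := by
          rw [← Finset.card_product]
          apply Finset.card_le_card
          refine (Finset.filter_subset _ _).trans ?_
          exact Finset.product_subset_product (Finset.filter_subset _ _) (Finset.filter_subset _ _)
        rw [sq, hndef]
        exact_mod_cast this
  -- choose v
  have h4 : ∃ v ∈ A, c ^ 2 * n ^ 2 / 8 ≤ (#(N v) : ℝ) ^ 2 - 16 / c * #(bad v) := by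
    apply Finset.exists_le_of_sum_le hA
    rw [Finset.sum_const, nsmul_eq_mul, Finset.sum_sub_distrib, ← Finset.mul_sum]
    have h2' : c ^ 2 / 4 * n ^ 3 ≤ ∑ v ∈ A, (#(N v) : ℝ) ^ 2 := by
      refine le_of_mul_le_mul_left ?_ hn
      refine le_trans (le_of_eq ?_) h2
      ring
    have h3' : 16 / c * ∑ v ∈ A, (#(bad v) : ℝ) ≤ c ^ 2 / 8 * n ^ 3 := by
      calc _ ≤ 16 / c * (c ^ 3 / 128 * n * n ^ 2) := by gcongr
        _ = _ := by field_simp; ring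
    rw [← hndef]
    nlinarith
  obtain ⟨v, hv, h5⟩ := h4
  set U := N v with hU
  have hUA0 : U ⊆ A0 := Finset.filter_subset _ _
  have hUA : U ⊆ A := hUA0.trans (Finset.filter_subset _ _)
  have hUbig : c / 3 * n ≤ (#U : ℝ) := by
    have : (0:ℝ) ≤ 16 / c * #(bad v) := by positivity
    have h6 : (c / 3 * n) ^ 2 ≤ (#U : ℝ) ^ 2 := by nlinarith [sq_nonneg (c * n)]
    exact le_of_sq_le_sq h6 (by positivity)
  have hUpos : (0:ℝ) < #U := lt_of_lt_of_le (by positivity) hUbig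
  have hbadU : (#(bad v) : ℝ) ≤ c / 16 * (#U : ℝ) ^ 2 := by
    have : 16 / c * #(bad v) ≤ (#U : ℝ) ^ 2 := by nlinarith [sq_nonneg (c * n)]
    calc (#(bad v) : ℝ) = c / 16 * (16 / c * #(bad v)) := by field_simp
      _ ≤ _ := by gcongr
  set bd : α → Finset α := fun x => U.filter (fun y => cod x y < c ^ 3 / 128 * n) with hbd
  have hbadsum : (#(bad v) : ℝ) = ∑ x ∈ U, (#(bd x) : ℝ) := by
    simp only [hbad, hbd]
    rw [← Nat.cast_sum]
    congr 1
    rw [Finset.card_filter, Finset.sum_product]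
    simp only [Finset.card_filter]
    rfl
  set X := U.filter (fun x => (#(bd x) : ℝ) ≤ c / 8 * #U) with hX
  set Y := A.filter (fun y => c / 4 * #U ≤ (#(U.filter (fun x => r x y)) : ℝ)) with hY
  refine ⟨X, (Finset.filter_subset _ _).trans hUA, Y, Finset.filter_subset _ _, ?_, ?_, ?_⟩
  · have e1 : (#(U.filter (fun x => ¬ (#(bd x) : ℝ) ≤ c / 8 * #U)) : ℝ) * (c / 8 * #U)
        ≤ c / 16 * (#U : ℝ) ^ 2 := by
      refine le_trans ?_ (hbadsum ▸ hbadU)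
      rw [← nsmul_eq_mul, ← Finset.sum_const]
      calc _ ≤ ∑ x ∈ U.filter (fun x => ¬ (#(bd x) : ℝ) ≤ c / 8 * #U), (#(bd x) : ℝ) := by
            apply Finset.sum_le_sum
            intro x hx
            exact (not_le.1 (Finset.mem_filter.1 hx).2).le
        _ ≤ _ := by
            apply Finset.sum_le_sum_of_subset_of_nonneg (Finset.filter_subset _ _)
            intros; positivity
    have e2 : (#X : ℝ) + #(U.filter (fun x => ¬ (#(bd x) : ℝ) ≤ c / 8 * #U)) = #U := by
      exact_mod_cast Finset.card_filter_add_card_filter_not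
        (s := U) (fun x => (#(bd x) : ℝ) ≤ c / 8 * #U)
    have e3 : (#(U.filter (fun x => ¬ (#(bd x) : ℝ) ≤ c / 8 * #U)) : ℝ) ≤ #U / 2 := by
      refine le_of_mul_le_mul_right (e1.trans (le_of_eq ?_)) (by positivity : 0 < c / 8 * #U)
      ring
    linarith
  · have e1 : c / 2 * n * #U ≤ ∑ y ∈ A, (#(U.filter (fun x => r x y)) : ℝ) := by
      have := Finset.sum_card_bipartiteAbove_eq_sum_card_bipartiteBelow (s := U) (t := A)
        (r := r)
      simp only [bipartiteAbove, bipartiteBelow] at this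
      rw [← Nat.cast_sum, ← this, Nat.cast_sum]
      rw [mul_comm, ← nsmul_eq_mul, ← Finset.sum_const]
      apply Finset.sum_le_sum
      intro x hx
      exact (Finset.mem_filter.1 (hUA0 hx)).2
    have e2 := Finset.sum_filter_add_sum_filter_not A
      (fun y => c / 4 * #U ≤ (#(U.filter (fun x => r x y)) : ℝ))
      (fun y => (#(U.filter (fun x => r x y)) : ℝ))
    have e3 : ∑ y ∈ Y, (#(U.filter (fun x => r x y)) : ℝ) ≤ #Y * #U := by
      rw [← nsmul_eq_mul, ← Finset.sum_const]
      apply Finset.sum_le_sum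
      intro y _
      exact_mod_cast Finset.card_le_card (Finset.filter_subset _ _)
    have e4 : ∑ y ∈ A.filter (fun y => ¬ c / 4 * #U ≤ (#(U.filter (fun x => r x y)) : ℝ)),
        (#(U.filter (fun x => r x y)) : ℝ) ≤ n * (c / 4 * #U) := by
      calc _ ≤ ∑ y ∈ A.filter (fun y => ¬ c / 4 * #U ≤ (#(U.filter (fun x => r x y)) : ℝ)),
              c / 4 * (#U : ℝ) := by
            apply Finset.sum_le_sum
            intro x hx
            exact (not_le.1 (Finset.mem_filter.1 hx).2).le
        _ ≤ _ := by
            rw [Finset.sum_const, nsmul_eq_mul]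
            refine mul_le_mul_of_nonneg_right ?_ (by positivity)
            exact Nat.cast_le.2 (Finset.card_le_card (Finset.filter_subset _ _))
    refine le_of_mul_le_mul_right ?_ hUpos
    linarith
  · intro x hx y hy
    have hx' := (Finset.mem_filter.1 hx).2
    have hy' := (Finset.mem_filter.1 hy).2
    set W := (U.filter (fun z => r z y)).filter (fun z => ¬ cod x z < c ^ 3 / 128 * n) with hW
    have hWbig : c / 8 * #U ≤ (#W : ℝ) := by
      have e1 : (#((U.filter (fun z => r z y)).filter (fun z => cod x z < c ^ 3 / 128 * n)) : ℝ)
          + #W = #(U.filter (fun z => r z y)) := by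
        have := Finset.card_filter_add_card_filter_not
          (s := U.filter (fun z => r z y)) (fun z => cod x z < c ^ 3 / 128 * n)
        rw [← hW] at this
        exact_mod_cast this
      have e2 : (#((U.filter (fun z => r z y)).filter (fun z => cod x z < c ^ 3 / 128 * n)) : ℝ)
          ≤ #(bd x) := by
        exact_mod_cast Finset.card_le_card
          (Finset.filter_subset_filter _ (Finset.filter_subset _ _))
      linarith
    have e3 : ∑ z ∈ W, cod x z ≤
        (#((A ×ˢ A).filter (fun p => r x p.1 ∧ r p.2 p.1 ∧ r p.2 y)) : ℝ) := by
      simp only [hcod]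
      rw [← Nat.cast_sum, ← Finset.card_sigma]
      rw [Nat.cast_le]
      apply Finset.card_le_card_of_injOn (fun q => (q.2, q.1))
      · rintro ⟨z, w⟩ hq
        simp only [Finset.mem_coe, Finset.mem_sigma, Finset.mem_filter, hW, Finset.mem_product] at hq ⊢
        have := hUA hq.1.1.1
        tauto
      · rintro ⟨z, w⟩ _ ⟨z', w'⟩ _ h
        simp only [Prod.mk.injEq] at h
        obtain ⟨rfl, rfl⟩ := h
        rfl
    refine le_trans ?_ e3
    calc c ^ 5 / 3072 * n ^ 2 = c / 8 * (c / 3 * n) * (c ^ 3 / 128 * n) := by ring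
      _ ≤ c / 8 * #U * (c ^ 3 / 128 * n) := by gcongr
      _ ≤ #W * (c ^ 3 / 128 * n) := by gcongr
      _ = ∑ z ∈ W, c ^ 3 / 128 * n := by rw [Finset.sum_const, nsmul_eq_mul]
      _ ≤ _ := by
        apply Finset.sum_le_sum
        intro z hz
        exact not_lt.1 (Finset.mem_filter.1 hz).2

open Finset Pointwise SimpleGraph TripartiteFromTriangles in
lemma count_aps (B : Finset ℝ) (ε : ℝ) (hε : 0 < ε)
    (h : ε * ((#B : ℝ) + #(1 • B - 1 • B) + #(2 • B - 1 • B)) ^ 2 ≤ (#B : ℝ) ^ 2) :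
    triangleRemovalBound ε * (#B : ℝ) ^ 3 ≤
      #B * #((B ×ˢ B).filter (fun p => (p.1 + p.2) / 2 ∈ B)) := by
  classical
  set Y := 1 • B - 1 • B with hY
  set Z := 2 • B - 1 • B with hZ
  let t : Finset (B × Y × Z) := Finset.univ.filter
    (fun p => (p.2.1 : ℝ) + p.1 ∈ B ∧ (p.2.2 : ℝ) = 2 * p.2.1 + p.1)
  have ht : ∀ x y z, (x, y, z) ∈ t ↔ ((y : ℝ) + x ∈ B ∧ (z : ℝ) = 2 * y + x) := by
    intro x y z; simp [t]
  have : ExplicitDisjoint t := by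
    constructor
    · intro a b c a' h1 h2
      rw [ht] at h1 h2
      ext; linarith
    · intro a b c a' h1 h2
      rw [ht] at h1 h2
      ext; linarith
    · intro a b c a' h1 h2
      rw [ht] at h1 h2
      ext; linarith
  have hcard : #B * #B ≤ #t := by
    rw [← Finset.card_product]
    have hy : ∀ p ∈ B ×ˢ B, p.2 - p.1 ∈ Y := by
      intro p hp
      rw [Finset.mem_product] at hp
      simp only [hY, one_smul]
      exact Finset.sub_mem_sub hp.2 hp.1
    have hz : ∀ p ∈ B ×ˢ B, p.2 + p.2 - p.1 ∈ Z := by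
      intro p hp
      rw [Finset.mem_product] at hp
      simp only [hZ, one_smul, two_smul]
      exact Finset.sub_mem_sub (Finset.add_mem_add hp.2 hp.2) hp.1
    rw [← Finset.card_attach]
    apply Finset.card_le_card_of_injOn (fun p => (⟨p.1.1, (Finset.mem_product.1 p.2).1⟩,
      ⟨p.1.2 - p.1.1, hy _ p.2⟩, ⟨p.1.2 + p.1.2 - p.1.1, hz _ p.2⟩))
    · intro p _
      rw [Finset.mem_coe, ht]
      refine ⟨?_, ?_⟩
      · simpa using (Finset.mem_product.1 p.2).2
      · simp only; ring
    · rintro ⟨⟨a, b⟩, _⟩ _ ⟨⟨a', b'⟩, _⟩ _ h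
      simp only [Prod.mk.injEq, Subtype.mk.injEq] at h ⊢
      obtain ⟨h1, h2, _⟩ := h
      exact ⟨h1, by linarith⟩
  have hfar : (graph t).FarFromTriangleFree ε := by
    apply farFromTriangleFree
    simp only [Fintype.card_coe]
    push_cast
    refine h.trans ?_
    rw [sq]
    exact_mod_cast hcard
  have hrem := hfar.le_card_cliqueFinset
  let t' : Finset (B × Y × Z) := Finset.univ.filter
    (fun p => (p.2.1 : ℝ) + p.1 ∈ B ∧ (p.2.2 : ℝ) - p.2.1 ∈ B ∧ ((p.2.2 : ℝ) + p.1) / 2 ∈ B)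
  have hsub : (graph t).cliqueFinset 3 ⊆ t'.map toTriangle := by
    intro s hs
    rw [mem_cliqueFinset_iff, is3Clique_iff] at hs
    obtain ⟨x, y, z, hxy, hxz, hyz, rfl⟩ := hs
    obtain ⟨a, b, c, habc, hab, hac, hbc⟩ := graph_triple hxy hxz hyz
    rw [← habc]
    obtain ⟨c', hc'⟩ := Graph.in₀₁_iff.1 hab
    obtain ⟨b', hb'⟩ := Graph.in₀₂_iff.1 hac
    obtain ⟨a', ha'⟩ := Graph.in₁₂_iff.1 hbc
    rw [ht] at hc' hb' ha'
    refine Finset.mem_map.2 ⟨(a, b, c), ?_, rfl⟩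
    simp only [t', Finset.mem_filter, Finset.mem_univ, true_and]
    refine ⟨hc'.1, ?_, ?_⟩
    · have := ha'.1
      rw [ha'.2]; convert this using 1; ring
    · have := hb'.1
      rw [hb'.2]; convert this using 1; ring
  have hle : #((graph t).cliqueFinset 3) ≤
      #B * #((B ×ˢ B).filter (fun p => (p.1 + p.2) / 2 ∈ B)) := by
    refine (Finset.card_le_card hsub).trans ?_
    rw [Finset.card_map, ← Finset.card_product]
    apply Finset.card_le_card_of_injOn
      (fun p => ((p.1 : ℝ), ((p.2.1 : ℝ) + p.1, (p.2.2 : ℝ) - p.2.1)))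
    · intro p hp
      simp only [t', Finset.mem_coe, Finset.mem_filter, Finset.mem_univ, true_and] at hp
      simp only [Finset.mem_coe, Finset.mem_filter, Finset.mem_product]
      refine ⟨p.1.2, ⟨hp.1, hp.2.1⟩, ?_⟩
      convert hp.2.2 using 1; ring
    · rintro ⟨⟨a, _⟩, ⟨b, _⟩, ⟨c, _⟩⟩ _ ⟨⟨a', _⟩, ⟨b', _⟩, ⟨c', _⟩⟩ _ h
      simp only [Prod.mk.injEq, Subtype.mk.injEq] at h ⊢
      obtain ⟨h1, h2, h3⟩ := h
      exact ⟨h1, by linarith, by linarith⟩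
  have hV : (#B : ℝ) ≤ Fintype.card (B ⊕ Y ⊕ Z) := by
    simp only [Fintype.card_sum, Fintype.card_coe]
    push_cast
    have : (0:ℝ) ≤ #Y := by positivity
    have : (0:ℝ) ≤ #Z := by positivity
    linarith
  have hpos := triangleRemovalBound_pos hε
  calc triangleRemovalBound ε * (#B : ℝ) ^ 3
      ≤ triangleRemovalBound ε * (Fintype.card (B ⊕ Y ⊕ Z) : ℝ) ^ 3 := by gcongr
    _ ≤ _ := hrem
    _ ≤ _ := by exact_mod_cast hle

open Finset Pointwise in
lemma sumset_bound (A : Finset ℝ) (E : Finset (ℝ × ℝ)) (X Y : Finset ℝ) (P : ℝ)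
    (hP : ∀ x ∈ X, ∀ y ∈ Y, P ≤
        (#((A ×ˢ A).filter (fun p => (x, p.1) ∈ E ∧ (p.2, p.1) ∈ E ∧ (p.2, y) ∈ E)) : ℝ)) :
    #(X + Y) * P ≤ (#(E.image (fun p => p.1 + p.2)) : ℝ) ^ 3 := by
  classical
  set S := E.image (fun p => p.1 + p.2) with hS
  have hrep : ∀ z : ℝ, ∃ q : ℝ × ℝ, z ∈ X + Y → q.1 ∈ X ∧ q.2 ∈ Y ∧ q.1 + q.2 = z := by
    intro z
    by_cases hz : z ∈ X + Y
    · obtain ⟨x, hx, y, hy, h⟩ := Finset.mem_add.1 hz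
      exact ⟨(x, y), fun _ => ⟨hx, hy, h⟩⟩
    · exact ⟨(0, 0), fun h => absurd h hz⟩
  choose q hq using hrep
  set F : ℝ → Finset (ℝ × ℝ) := fun z => (A ×ˢ A).filter
    (fun p => ((q z).1, p.1) ∈ E ∧ (p.2, p.1) ∈ E ∧ (p.2, (q z).2) ∈ E) with hF
  have hmemS : ∀ a b : ℝ, (a, b) ∈ E → a + b ∈ S := by
    intro a b h
    exact Finset.mem_image.2 ⟨(a, b), h, rfl⟩
  have h1 : ∑ z ∈ X + Y, #(F z) ≤ #(S ×ˢ S ×ˢ S) := by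
    rw [← Finset.card_sigma]
    apply Finset.card_le_card_of_injOn
      (fun w => ((q w.1).1 + w.2.1, w.2.2 + w.2.1, w.2.2 + (q w.1).2))
    · rintro ⟨z, p⟩ hw
      simp only [hF, Finset.mem_coe, Finset.mem_sigma, Finset.mem_filter] at hw
      simp only [Finset.mem_coe, Finset.mem_product]
      exact ⟨hmemS _ _ hw.2.2.1, hmemS _ _ hw.2.2.2.1, hmemS _ _ hw.2.2.2.2⟩
    · rintro ⟨z, p1, p2⟩ hw ⟨z', p1', p2'⟩ hw' h
      simp only [Finset.mem_coe, Finset.mem_sigma] at hw hw'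
      simp only [Prod.mk.injEq] at h
      obtain ⟨e1, e2, e3⟩ := h
      have g := (hq z hw.1).2.2
      have g' := (hq z' hw'.1).2.2
      have hz : z = z' := by linarith
      subst hz
      have a1 : p1 = p1' := by linarith
      have a2 : p2 = p2' := by linarith
      rw [a1, a2]
  have h2 : #(X + Y) * P ≤ ∑ z ∈ X + Y, (#(F z) : ℝ) := by
    rw [← nsmul_eq_mul, ← Finset.sum_const]
    apply Finset.sum_le_sum
    intro z hz
    exact hP _ (hq z hz).1 _ (hq z hz).2.1
  refine h2.trans ?_
  rw [Finset.card_product, Finset.card_product] at h1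
  calc ∑ z ∈ X + Y, (#(F z) : ℝ) ≤ ((#S * (#S * #S) : ℕ) : ℝ) := by exact_mod_cast h1
    _ = _ := by push_cast; ring

open Finset in
lemma ap_count (A X : Finset ℝ) (hX : X ⊆ A) :
    (#((X ×ˢ X).filter (fun p => (p.1 + p.2) / 2 ∈ X)) : ℝ) ≤
      ({q : ℝ × ℝ | q.2 ≠ 0 ∧ q.1 ∈ A ∧ q.1 + q.2 ∈ A ∧ q.1 + 2 * q.2 ∈ A}.ncard : ℝ) + #A := by
  classical
  set Q := {q : ℝ × ℝ | q.2 ≠ 0 ∧ q.1 ∈ A ∧ q.1 + q.2 ∈ A ∧ q.1 + 2 * q.2 ∈ A} with hQ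
  have hfin : Q.Finite := by
    apply ((A ×ˢ A).image (fun p => (p.1, p.2 - p.1))).finite_toSet.subset
    rintro ⟨x, d⟩ ⟨_, h1, h2, _⟩
    simp only [Finset.coe_image, Set.mem_image, Finset.mem_coe, Finset.mem_product]
    exact ⟨(x, x + d), ⟨h1, h2⟩, by simp⟩
  set T := (X ×ˢ X).filter (fun p => (p.1 + p.2) / 2 ∈ X) with hT
  have hsplit := Finset.card_filter_add_card_filter_not (s := T) (fun p => p.1 = p.2)
  have hdiag : #(T.filter (fun p => p.1 = p.2)) ≤ #A := by
    apply Finset.card_le_card_of_injOn (fun p => p.1)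
    · intro p hp
      simp only [hT, Finset.mem_coe, Finset.mem_filter, Finset.mem_product] at hp
      exact hX hp.1.1.1
    · rintro ⟨a, b⟩ hp ⟨a', b'⟩ hp' h
      simp only [Finset.mem_coe, Finset.mem_filter] at hp hp' h
      rw [Prod.mk.injEq, ← hp.2, ← hp'.2]
      exact ⟨h, h⟩
  have hoff : #(T.filter (fun p => ¬ p.1 = p.2)) ≤ Q.ncard := by
    rw [Set.ncard_eq_toFinset_card Q hfin]
    apply Finset.card_le_card_of_injOn (fun p => (p.1, (p.2 - p.1) / 2))
    · rintro ⟨a, b⟩ hp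
      simp only [hT, Finset.mem_coe, Finset.mem_filter, Finset.mem_product] at hp
      simp only [Finset.mem_coe, Set.Finite.mem_toFinset, hQ, Set.mem_ofPred_eq]
      refine ⟨?_, hX hp.1.1.1, ?_, ?_⟩
      · intro h; apply hp.2; linarith
      · have := hX hp.1.2
        convert this using 1; ring
      · have := hX hp.1.1.2
        convert this using 1; ring
    · rintro ⟨a, b⟩ _ ⟨a', b'⟩ _ h
      simp only [Prod.mk.injEq] at h ⊢
      exact ⟨h.1, by linarith⟩
  have : #T ≤ Q.ncard + #A := by omega
  exact_mod_cast this

open Finset Pointwise in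
lemma pr_real (X Y : Finset ℝ) (hY : Y.Nonempty) (M : ℝ) (hM : (#(X + Y) : ℝ) ≤ M * #Y)
    (k : ℕ) : (#(k • X - 1 • X) : ℝ) ≤ M ^ (k + 1) * #Y := by
  have h := Finset.pluennecke_ruzsa_inequality_nsmul_sub_nsmul_add hY X k 1
  have h' : (#(k • X - 1 • X) : ℝ) ≤ ((#(Y + X) : ℝ) / #Y) ^ (k + 1) * #Y := by
    have h2 := (NNRat.cast_le (K := ℝ)).2 h
    push_cast at h2
    exact h2
  have hYp : (0:ℝ) < #Y := by exact_mod_cast hY.card_pos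
  refine h'.trans ?_
  gcongr
  rw [div_le_iff₀ hYp, add_comm]
  exact hM

open Pointwise in
/-- For all real constants `c > 0` and `K > 0` there exist a threshold
`n₀ = n₀(c, K)` and a constant `δ > 0` such that: if `A` is a finite set of reals with
`|A| = n ≥ n₀`, and `G` is a graph on vertex set `A` (symmetric edge set `E ⊆ A × A`) with at
least `c·n²` edges and `|A +_G A| ≤ K·|A|`, then `A` contains at least `δ·n²` three-term
arithmetic progressions, i.e. pairs `(x, d)` with `d ≠ 0` and `x, x+d, x+2d ∈ A`. -/
theorem stmt_1 (c K : ℝ) (hc : 0 < c) (hK : 0 < K) :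
    ∃ (n₀ : ℕ) (δ : ℝ), 0 < δ ∧
      ∀ (A : Finset ℝ) (E : Finset (ℝ × ℝ)),
        n₀ ≤ A.card →
        (∀ p ∈ E, p.1 ∈ A ∧ p.2 ∈ A) →
        (∀ p ∈ E, (p.2, p.1) ∈ E) →
        c * (A.card : ℝ) ^ 2 ≤ (E.card : ℝ) →
        ((E.image (fun p => p.1 + p.2)).card : ℝ) ≤ K * (A.card : ℝ) →
        δ * (A.card : ℝ) ^ 2 ≤
          ({q : ℝ × ℝ | q.2 ≠ 0 ∧ q.1 ∈ A ∧ q.1 + q.2 ∈ A ∧ q.1 + 2 * q.2 ∈ A}.ncard : ℝ) := by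
  classical
  set M : ℝ := (3072 * K ^ 3 / c ^ 5) / (c / 4) with hMdef
  have hMpos : 0 < M := by positivity
  set ε : ℝ := (c / 6) ^ 2 / (1 + M ^ 2 + M ^ 3) ^ 2 with hεdef
  have hε : 0 < ε := by positivity
  set τ := SimpleGraph.triangleRemovalBound ε with hτdef
  have hτ : 0 < τ := SimpleGraph.triangleRemovalBound_pos hε
  set δ : ℝ := τ * (c / 6) ^ 2 / 2 with hδdef
  have hδ : 0 < δ := by positivity
  refine ⟨⌈1 / δ⌉₊ + 1, δ, hδ, ?_⟩
  intro A E hn hEA _ hE hS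
  have hApos : 0 < A.card := by omega
  have hA : A.Nonempty := Finset.card_pos.1 hApos
  set n : ℝ := (A.card : ℝ) with hndef
  have hn0 : 0 < n := Nat.cast_pos.2 hApos
  have hnδ : 1 / δ ≤ n := by
    refine (Nat.le_ceil _).trans ?_
    exact Nat.cast_le.2 ((Nat.le_succ _).trans hn)
  have hEsum : c * n ^ 2 ≤ ∑ x ∈ A, ((A.filter (fun y => (x, y) ∈ E)).card : ℝ) := by
    refine hE.trans ?_
    rw [← Nat.cast_sum, ← Finset.card_sigma, Nat.cast_le]
    apply Finset.card_le_card_of_injOn (fun p => (⟨p.1, p.2⟩ : Σ _ : ℝ, ℝ))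
    · intro p hp
      have := hEA p hp
      simp only [Finset.mem_coe, Finset.mem_sigma, Finset.mem_filter]
      exact ⟨this.1, this.2, hp⟩
    · rintro ⟨a, b⟩ _ ⟨a', b'⟩ _ h
      simpa using h
  obtain ⟨X, hXA, Y, hYA, hX, hY, hP⟩ := bsg_graph A (fun x y => (x, y) ∈ E) c hc hA hEsum
  rw [← hndef] at hX hY hP
  have hsum := sumset_bound A E X Y _ hP
  have hYpos : (0:ℝ) < Y.card := lt_of_lt_of_le (by positivity) hY
  have hXpos : (0:ℝ) < X.card := lt_of_lt_of_le (by positivity) hX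
  have hYne : Y.Nonempty := Finset.card_pos.1 (by exact_mod_cast hYpos)
  have hYn : (Y.card : ℝ) ≤ n := Nat.cast_le.2 (Finset.card_le_card hYA)
  have hXn : (X.card : ℝ) ≤ n := Nat.cast_le.2 (Finset.card_le_card hXA)
  have hXY : ((X + Y).card : ℝ) ≤ M * Y.card := by
    have h1 : ((X + Y).card : ℝ) * (c ^ 5 / 3072 * n ^ 2) ≤ (K * n) ^ 3 :=
      hsum.trans (by gcongr)
    have h2 : ((X + Y).card : ℝ) ≤ M * (c / 4 * n) := by
      refine le_of_mul_le_mul_right (h1.trans (le_of_eq ?_))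
        (by positivity : 0 < c ^ 5 / 3072 * n ^ 2)
      rw [hMdef]; field_simp
    exact h2.trans (by gcongr)
  have hd1 := pr_real X Y hYne M hXY 1
  have hd2 := pr_real X Y hYne M hXY 2
  have hcount := count_aps X ε hε (by
    have : (X.card : ℝ) + (1 • X - 1 • X).card + (2 • X - 1 • X).card
        ≤ (1 + M ^ 2 + M ^ 3) * n := by
      have a1 : M ^ (1 + 1) * (Y.card : ℝ) ≤ M ^ 2 * n := by gcongr
      have a2 : M ^ (2 + 1) * (Y.card : ℝ) ≤ M ^ 3 * n := by gcongr
      linarith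
    calc _ ≤ ε * ((1 + M ^ 2 + M ^ 3) * n) ^ 2 := by gcongr
      _ = (c / 6 * n) ^ 2 := by rw [hεdef]; field_simp
      _ ≤ _ := by gcongr)
  have hap := ap_count A X hXA
  rw [← hτdef] at hcount
  have h3 : τ * (X.card : ℝ) ^ 2 ≤
      (((X ×ˢ X).filter (fun p => (p.1 + p.2) / 2 ∈ X)).card : ℝ) := by
    refine le_of_mul_le_mul_left (le_trans (le_of_eq ?_) hcount) hXpos
    ring
  have h4 : τ * (c / 6 * n) ^ 2 ≤ τ * (X.card : ℝ) ^ 2 := by gcongr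
  have h5 : n ≤ δ * n ^ 2 := by
    rw [div_le_iff₀ hδ] at hnδ
    nlinarith
  have h6 : τ * (c / 6 * n) ^ 2 = 2 * (δ * n ^ 2) := by rw [hδdef]; ring
  linarith
end

section
/- For every real constant c > 0 there exist a threshold n₀ and a constant δ > 0 depending only on c such that the following holds. Let G be a (simple) graph on n ≥ n₀ vertices whose edge set is the union of a family of at least c·n² pairwise edge-disjoint triangles. Then G contains at least δ·n³ triangles (triples of vertices pairwise joined by edges of G). -/
/-- **Ruzsa–Szemerédi.** For every `c > 0` there are a threshold `n₀` and a
constant `δ > 0` depending only on `c` such that: if `G` is a simple graph on `n ≥ n₀` vertices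
whose edge set is the union of a family `𝒯` of at least `c·n²` pairwise edge-disjoint triangles
(every edge of `G` lies in a triangle of the family, the triangles of the family are triangles
of `G`, and distinct members share at most one vertex, hence no edge), then `G` contains at
least `δ·n³` triangles. -/
theorem stmt_3 (c : ℝ) (hc : 0 < c) :
    ∃ (n₀ : ℕ) (δ : ℝ), 0 < δ ∧
      ∀ (V : Type) [Fintype V] [DecidableEq V] (G : SimpleGraph V) [DecidableRel G.Adj]
        (𝒯 : Finset (Finset V)),
        n₀ ≤ Fintype.card V →
        (∀ t ∈ 𝒯, t.card = 3 ∧ ∀ u ∈ t, ∀ v ∈ t, u ≠ v → G.Adj u v) →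
        (∀ t₁ ∈ 𝒯, ∀ t₂ ∈ 𝒯, t₁ ≠ t₂ → (t₁ ∩ t₂).card ≤ 1) →
        (∀ u v : V, G.Adj u v → ∃ t ∈ 𝒯, u ∈ t ∧ v ∈ t) →
        c * (Fintype.card V : ℝ) ^ 2 ≤ (𝒯.card : ℝ) →
        δ * (Fintype.card V : ℝ) ^ 3 ≤ ((G.cliqueFinset 3).card : ℝ) := by
  refine ⟨0, SimpleGraph.triangleRemovalBound c, SimpleGraph.triangleRemovalBound_pos hc, ?_⟩
  intro V _ _ G _ 𝒯 _ h1 h2 _ h4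
  have hfar : G.FarFromTriangleFree c := by
    refine SimpleGraph.farFromTriangleFree_of_disjoint_triangles 𝒯 ?_ ?_ ?_
    · intro t ht
      rw [SimpleGraph.mem_cliqueFinset_iff, SimpleGraph.isNClique_iff]
      refine ⟨?_, (h1 t ht).1⟩
      intro u hu v hv huv
      exact (h1 t ht).2 u hu v hv huv
    · intro t₁ ht₁ t₂ ht₂ hne
      intro x hx y hy
      exact Finset.card_le_one.1 (h2 t₁ ht₁ t₂ ht₂ hne) x (Finset.mem_inter.2 hx)
        y (Finset.mem_inter.2 hy)
    · exact_mod_cast h4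
  exact hfar.le_card_cliqueFinset
end

section
/- For all real constants ε > 0, c > 0 and K > 0 there exists a constant D = D(ε, c, K) such that the following holds for every sufficiently large finite set A of real numbers. If G is a graph with vertex set A satisfying |A +_G A| ≤ K·|A| and |E(G)| ≥ c·|A|², then there is a subgraph G′ ⊆ G (same vertex set, edge set contained in E(G)) such that |E(G′)| ≥ (1 − ε)·|E(G)| and the difference-set along G′ satisfies |A −_{G′} A| ≤ D·|A|. -/
open Classical in
/-- Edge indicator. -/
noncomputable def eInd (E : Finset (ℝ × ℝ)) (x y : ℝ) : ℝ := if (x, y) ∈ E then 1 else 0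

lemma eInd_nonneg (E : Finset (ℝ × ℝ)) (x y : ℝ) : 0 ≤ eInd E x y := by
  unfold eInd; split_ifs <;> norm_num

lemma eInd_le_one (E : Finset (ℝ × ℝ)) (x y : ℝ) : eInd E x y ≤ 1 := by
  unfold eInd; split_ifs <;> norm_num

lemma eInd_of_mem {E : Finset (ℝ × ℝ)} {x y : ℝ} (h : (x, y) ∈ E) : eInd E x y = 1 := by
  simp [eInd, h]

lemma eInd_sum {A : Finset ℝ} {E : Finset (ℝ × ℝ)} (hE : ∀ p ∈ E, p.1 ∈ A ∧ p.2 ∈ A) :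
    ∑ x ∈ A, ∑ y ∈ A, eInd E x y = (E.card : ℝ) := by
  classical
  rw [← Finset.sum_product']
  have : ∀ p ∈ A ×ˢ A, eInd E p.1 p.2 = if p ∈ E then (1 : ℝ) else 0 := by
    intro p _; simp [eInd]
  rw [Finset.sum_congr rfl this, ← Finset.sum_filter, Finset.sum_const, nsmul_eq_mul, mul_one]
  congr 2
  ext p
  simp only [Finset.mem_filter, Finset.mem_product]
  exact ⟨fun h => h.2, fun h => ⟨hE p h, h⟩⟩

lemma sum_le_card_real {A : Finset ℝ} (f : ℝ → ℝ) (C : ℝ) (h : ∀ x ∈ A, f x ≤ C) :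
    ∑ x ∈ A, f x ≤ A.card * C := by
  simpa [nsmul_eq_mul] using Finset.sum_le_card_nsmul A f C h

set_option maxHeartbeats 2000000 in
lemma graph_lemma (η : ℝ) (hη : 0 < η) : ∃ α β : ℝ, 0 < α ∧ 0 < β ∧
    ∀ (A : Finset ℝ) (E : Finset (ℝ × ℝ)), 0 < A.card → (∀ p ∈ E, p.1 ∈ A ∧ p.2 ∈ A) →
      η * (A.card : ℝ) ^ 2 ≤ (E.card : ℝ) →
      ∃ F ⊆ E, α * (A.card : ℝ) ^ 2 ≤ (F.card : ℝ) ∧ ∀ p ∈ F, ∀ q ∈ F,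
        β * (A.card : ℝ) ^ 2 ≤
          ∑ x ∈ A, ∑ y ∈ A, eInd E x q.2 * eInd E x y * eInd E p.1 y := by
  classical
  obtain ⟨l, hl⟩ : ∃ l : ℝ, l = η ^ 2 / 8 := ⟨_, rfl⟩
  have hl0 : 0 < l := by rw [hl]; positivity
  refine ⟨2 * l, l ^ 4, by positivity, by positivity, ?_⟩
  intro A E hA hE hcard
  obtain ⟨n, hn⟩ : ∃ n : ℝ, n = (A.card : ℝ) := ⟨_, rfl⟩
  have hn0 : 0 < n := by rw [hn]; exact_mod_cast hA
  rw [← hn] at hcard ⊢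
  set e := eInd E with he
  have e0 : ∀ x y, 0 ≤ e x y := eInd_nonneg E
  have e1 : ∀ x y, e x y ≤ 1 := eInd_le_one E
  set deg : ℝ → ℝ := fun x => ∑ y ∈ A, e x y with hdeg
  set cod : ℝ → ℝ → ℝ := fun x x' => ∑ y ∈ A, e x y * e x' y with hcod
  set δ : ℝ := 2 * l ^ 3 with hδ
  set bad : ℝ → ℝ → ℝ := fun x x' => if cod x x' < δ * n then 1 else 0 with hbad
  have b0 : ∀ x y, 0 ≤ bad x y := by intro x y; simp only [hbad]; split_ifs <;> norm_num
  have b1 : ∀ x y, bad x y ≤ 1 := by intro x y; simp only [hbad]; split_ifs <;> norm_num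
  have hsum : ∑ x ∈ A, deg x = (E.card : ℝ) := eInd_sum hE
  have hdeg2 : η ^ 2 * n ^ 3 ≤ ∑ x ∈ A, deg x ^ 2 := by
    have h := sq_sum_le_card_mul_sum_sq (s := A) (f := deg)
    rw [hsum, ← hn] at h
    have h2 : (η * n ^ 2) ^ 2 ≤ (E.card : ℝ) ^ 2 := by gcongr
    have h3 : n * (η ^ 2 * n ^ 3) ≤ n * ∑ x ∈ A, deg x ^ 2 := by nlinarith
    exact le_of_mul_le_mul_left h3 hn0
  have hD : ∑ y0 ∈ A, ∑ x ∈ A, e x y0 * deg x = ∑ x ∈ A, deg x ^ 2 := by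
    rw [Finset.sum_comm]
    refine Finset.sum_congr rfl fun x _ => ?_
    rw [← Finset.sum_mul, sq]
  have hB : ∑ y0 ∈ A, ∑ x ∈ A, ∑ x' ∈ A, e x y0 * e x' y0 * bad x x' ≤ δ * n ^ 3 := by
    rw [Finset.sum_comm]
    have : ∀ x ∈ A, ∑ y0 ∈ A, ∑ x' ∈ A, e x y0 * e x' y0 * bad x x' ≤ n * (δ * n) := by
      intro x _
      rw [Finset.sum_comm, hn]
      refine sum_le_card_real _ _ fun x' _ => ?_
      rw [← Finset.sum_mul, ← hn]
      change cod x x' * bad x x' ≤ _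
      simp only [hbad]
      split_ifs with h
      · linarith
      · rw [mul_zero]; positivity
    have h2 := sum_le_card_real _ _ this
    rw [← hn] at h2
    linarith [h2]
  obtain ⟨y0, hy0, hG⟩ : ∃ y0 ∈ A, 4 * l * n ^ 2 ≤ ∑ x ∈ A, e x y0 * deg x
      - 2 / l ^ 2 * ∑ x ∈ A, ∑ x' ∈ A, e x y0 * e x' y0 * bad x x' := by
    apply Finset.exists_le_of_sum_le (Finset.card_pos.1 hA)
    rw [Finset.sum_sub_distrib, hD, Finset.sum_const, nsmul_eq_mul, ← hn,
      ← Finset.mul_sum A _ (2 / l ^ 2)]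
    have h1 := mul_le_mul_of_nonneg_left hB (by positivity : 0 ≤ 2 / l ^ 2)
    have h2 : 2 / l ^ 2 * (δ * n ^ 3) = 4 * l * n ^ 3 := by rw [hδ]; field_simp; ring
    have h3 : η ^ 2 = 8 * l := by rw [hl]; ring
    rw [h3] at hdeg2
    nlinarith
  set Bad := ∑ x ∈ A, ∑ x' ∈ A, e x y0 * e x' y0 * bad x x' with hBad
  have hBad0 : 0 ≤ Bad := Finset.sum_nonneg fun x _ => Finset.sum_nonneg fun y _ =>
    mul_nonneg (mul_nonneg (e0 _ _) (e0 _ _)) (b0 _ _)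
  have hdegn : ∀ x, deg x ≤ n := by
    intro x
    have := sum_le_card_real (A := A) (fun y => e x y) 1 fun y _ => e1 x y
    rw [← hn] at this; linarith
  have hdeg0 : ∀ x, 0 ≤ deg x := fun x => Finset.sum_nonneg fun y _ => e0 x y
  have hDn : ∑ x ∈ A, e x y0 * deg x ≤ n * n := by
    rw [hn]
    refine sum_le_card_real _ _ fun x _ => ?_
    rw [← hn]
    nlinarith [e0 x y0, e1 x y0, hdegn x, hdeg0 x]
  have hBadn : Bad ≤ l ^ 2 / 2 * n ^ 2 := by
    have h1 : 2 / l ^ 2 * Bad ≤ n ^ 2 := by nlinarith [mul_pos hl0 (pow_pos hn0 2)]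
    rw [div_mul_eq_mul_div, div_le_iff₀ (by positivity)] at h1
    linarith
  have hDl : 4 * l * n ^ 2 ≤ ∑ x ∈ A, e x y0 * deg x := by
    have : 0 ≤ 2 / l ^ 2 * Bad := by positivity
    linarith
  set cb : ℝ → ℝ := fun b => ∑ x ∈ A, e x y0 * e x b with hcb
  set Ba : ℝ → ℝ := fun a => ∑ x ∈ A, e x y0 * bad x a with hBa
  have Ba0 : ∀ a, 0 ≤ Ba a := fun a => Finset.sum_nonneg fun x _ => mul_nonneg (e0 _ _) (b0 _ _)
  have hBadBa : Bad = ∑ a ∈ A, e a y0 * Ba a := by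
    rw [hBad, Finset.sum_comm]
    refine Finset.sum_congr rfl fun a _ => ?_
    rw [hBa, Finset.mul_sum]
    refine Finset.sum_congr rfl fun x _ => by ring
  set F := E.filter fun p => (p.1, y0) ∈ E ∧ l * n ≤ cb p.2 ∧ Ba p.1 < l * n / 2 with hF
  refine ⟨F, Finset.filter_subset _ _, ?_, ?_⟩
  · have hFE : ∀ p ∈ F, p.1 ∈ A ∧ p.2 ∈ A := fun p hp => hE p (Finset.mem_filter.1 hp).1
    rw [← eInd_sum hFE]
    set gb : ℝ → ℝ := fun b => if l * n ≤ cb b then 0 else 1 with hgb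
    set ga : ℝ → ℝ := fun a => if Ba a < l * n / 2 then 0 else 1 with hga
    have key : ∀ a b, e a y0 * e a b - gb b * (e a y0 * e a b) - ga a * e a y0 ≤ eInd F a b := by
      intro a b
      have hFab : (a, b) ∈ F ↔ (a, b) ∈ E ∧ (a, y0) ∈ E ∧ l * n ≤ cb b ∧ Ba a < l * n / 2 := by
        rw [hF, Finset.mem_filter]
      simp only [hgb, hga, he, eInd, hFab]
      by_cases h1 : (a, b) ∈ E <;> by_cases h2 : (a, y0) ∈ E <;>
        by_cases h3 : l * n ≤ cb b <;> by_cases h4 : Ba a < l * n / 2 <;>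
        simp only [h1, h2, h3, h4, if_true, if_false, and_true, true_and, and_false, false_and] <;>
        norm_num
    have hk2 : ∑ a ∈ A, ∑ b ∈ A, (e a y0 * e a b - gb b * (e a y0 * e a b) - ga a * e a y0)
        ≤ ∑ a ∈ A, ∑ b ∈ A, eInd F a b :=
      Finset.sum_le_sum fun a _ => Finset.sum_le_sum fun b _ => key a b
    refine le_trans ?_ hk2
    simp only [Finset.sum_sub_distrib]
    have t1 : ∑ a ∈ A, ∑ b ∈ A, e a y0 * e a b = ∑ a ∈ A, e a y0 * deg a :=
      Finset.sum_congr rfl fun a _ => by rw [hdeg, Finset.mul_sum]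
    have t2 : ∑ a ∈ A, ∑ b ∈ A, gb b * (e a y0 * e a b) ≤ n * (l * n) := by
      rw [Finset.sum_comm, hn]
      refine sum_le_card_real _ _ fun b _ => ?_
      rw [← Finset.mul_sum, ← hn]
      change gb b * cb b ≤ _
      simp only [hgb]
      split_ifs with h
      · rw [zero_mul]; positivity
      · push Not at h; linarith
    have t3 : ∑ a ∈ A, ∑ b ∈ A, ga a * e a y0 ≤ l * n ^ 2 := by
      simp only [Finset.sum_const, nsmul_eq_mul, ← hn, ← Finset.mul_sum]
      have h5 : (l * n / 2) * ∑ a ∈ A, ga a * e a y0 ≤ Bad := by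
        rw [hBadBa, Finset.mul_sum]
        refine Finset.sum_le_sum fun a _ => ?_
        simp only [hga]
        split_ifs with h
        · have := mul_nonneg (e0 a y0) (Ba0 a); linarith
        · push Not at h
          have := mul_le_mul_of_nonneg_left h (e0 a y0); linarith
      have h6 : (l * n / 2) * ∑ a ∈ A, ga a * e a y0 ≤ (l * n / 2) * (l * n) := by
        linarith
      have h7 := le_of_mul_le_mul_left h6 (by positivity)
      nlinarith
    rw [t1]
    linarith
  · intro p hp q hq
    have hp2 := (Finset.mem_filter.1 hp).2.2.2
    have hq2 := (Finset.mem_filter.1 hq).2.2.1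
    have h1 : ∑ x ∈ A, (e x y0 * e x q.2 - e x y0 * bad x p.1) * (δ * n) ≤
        ∑ x ∈ A, ∑ y ∈ A, e x q.2 * e x y * e p.1 y := by
      refine Finset.sum_le_sum fun x _ => ?_
      have h2 : ∑ y ∈ A, e x q.2 * e x y * e p.1 y = e x q.2 * cod x p.1 := by
        rw [hcod, Finset.mul_sum]
        exact Finset.sum_congr rfl fun y _ => by ring
      rw [h2]
      have hδn : 0 ≤ δ * n := by positivity
      have hc0 : 0 ≤ cod x p.1 := Finset.sum_nonneg fun y _ => mul_nonneg (e0 _ _) (e0 _ _)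
      have := e0 x y0
      have := e1 x y0
      have := e0 x q.2
      have := e1 x q.2
      simp only [hbad]
      split_ifs with h
      · have h8 : e x y0 * e x q.2 - e x y0 * 1 ≤ 0 := by nlinarith
        have h9 : 0 ≤ e x q.2 * cod x p.1 := by positivity
        nlinarith
      · push Not at h
        have h8 : e x y0 * e x q.2 ≤ e x q.2 := by nlinarith
        calc (e x y0 * e x q.2 - e x y0 * 0) * (δ * n) ≤ e x q.2 * (δ * n) := by
              rw [mul_zero, sub_zero]; gcongr
          _ ≤ _ := by gcongr
    refine le_trans ?_ h1
    rw [← Finset.sum_mul, Finset.sum_sub_distrib]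
    change _ ≤ (cb q.2 - Ba p.1) * (δ * n)
    have h2 : l * n / 2 ≤ cb q.2 - Ba p.1 := by linarith
    calc l ^ 4 * n ^ 2 = (l * n / 2) * (δ * n) := by rw [hδ]; ring
      _ ≤ _ := by gcongr

lemma energy_lemma (F : Finset (ℝ × ℝ)) (N : ℝ)
    (hS : ((F.image (fun p => p.1 + p.2)).card : ℝ) ≤ N) :
    (F.card : ℝ) ^ 2 ≤ N * ∑ p ∈ F, ∑ q ∈ F, (if p.1 + p.2 = q.1 + q.2 then (1 : ℝ) else 0) := by
  classical
  set S := F.image (fun p => p.1 + p.2) with hSdef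
  set r : ℝ → ℝ := fun s => ∑ p ∈ F, if p.1 + p.2 = s then (1 : ℝ) else 0 with hr
  have h1 : ∑ s ∈ S, r s = F.card := by
    rw [hr, Finset.sum_comm]
    have : ∀ p ∈ F, (∑ s ∈ S, if p.1 + p.2 = s then (1 : ℝ) else 0) = 1 := by
      intro p hp
      rw [Finset.sum_ite_eq, if_pos (Finset.mem_image_of_mem (fun p : ℝ × ℝ => p.1 + p.2) hp)]
    rw [Finset.sum_congr rfl this]; simp
  have h2 : ∑ s ∈ S, r s ^ 2 =
      ∑ p ∈ F, ∑ q ∈ F, (if p.1 + p.2 = q.1 + q.2 then (1 : ℝ) else 0) := by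
    have h3 : ∀ s ∈ S, r s ^ 2 = ∑ p ∈ F, (if p.1 + p.2 = s then r (p.1 + p.2) else 0) := by
      intro s _
      rw [sq]
      nth_rewrite 1 [hr]
      rw [Finset.sum_mul]
      refine Finset.sum_congr rfl fun p _ => ?_
      split_ifs with h
      · rw [h, one_mul]
      · rw [zero_mul]
    rw [Finset.sum_congr rfl h3, Finset.sum_comm]
    refine Finset.sum_congr rfl fun p hp => ?_
    rw [Finset.sum_ite_eq, if_pos (Finset.mem_image_of_mem (fun p : ℝ × ℝ => p.1 + p.2) hp)]
    refine Finset.sum_congr rfl fun q _ => ?_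
    simp only [eq_comm]
  have h := sq_sum_le_card_mul_sum_sq (s := S) (f := r)
  rw [h1] at h
  rw [← h2]
  exact h.trans (mul_le_mul_of_nonneg_right hS (Finset.sum_nonneg fun s _ => sq_nonneg _))

set_option maxHeartbeats 2000000 in
lemma core_lemma (η K : ℝ) (hη : 0 < η) (hK : 0 < K) : ∃ γ C : ℝ, 0 < γ ∧ 0 < C ∧
    ∀ (A : Finset ℝ) (E : Finset (ℝ × ℝ)), 0 < A.card → (∀ p ∈ E, p.1 ∈ A ∧ p.2 ∈ A) →
      ((E.image (fun p => p.1 + p.2)).card : ℝ) ≤ K * (A.card : ℝ) →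
      η * (A.card : ℝ) ^ 2 ≤ (E.card : ℝ) →
      ∃ E₁ ⊆ E, γ * (A.card : ℝ) ^ 2 ≤ (E₁.card : ℝ) ∧
        ((E₁.image (fun p => p.1 - p.2)).card : ℝ) ≤ C * (A.card : ℝ) := by
  classical
  obtain ⟨α, β, hα, hβ, hgr⟩ := graph_lemma η hη
  obtain ⟨g, hg⟩ : ∃ g : ℝ, g = α ^ 2 * β / K := ⟨_, rfl⟩
  have hg0 : 0 < g := by rw [hg]; positivity
  refine ⟨g / 2, 2 * K ^ 2 / g, by positivity, by positivity, ?_⟩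
  intro A E hA hE hS hcard
  obtain ⟨F, hFE, hFc, hFp⟩ := hgr A E hA hE hcard
  obtain ⟨n, hn⟩ : ∃ n : ℝ, n = (A.card : ℝ) := ⟨_, rfl⟩
  have hn0 : 0 < n := by rw [hn]; exact_mod_cast hA
  rw [← hn] at hcard hS hFc hFp ⊢
  set e := eInd E with he
  have e0 : ∀ x y, 0 ≤ e x y := eInd_nonneg E
  have e1 : ∀ x y, e x y ≤ 1 := eInd_le_one E
  have hSF : ((F.image (fun p => p.1 + p.2)).card : ℝ) ≤ K * n := by
    refine le_trans ?_ hS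
    exact_mod_cast Finset.card_le_card (Finset.image_subset_image hFE)
  have hen := energy_lemma F (K * n) hSF
  set En := ∑ p ∈ F, ∑ q ∈ F, (if p.1 + p.2 = q.1 + q.2 then (1 : ℝ) else 0) with hEn
  have hEn2 : α ^ 2 * n ^ 3 ≤ K * En := by
    have h1 : (α * n ^ 2) ^ 2 ≤ (F.card : ℝ) ^ 2 := by gcongr
    have h2 : n * (α ^ 2 * n ^ 3) ≤ n * (K * En) := by nlinarith
    exact le_of_mul_le_mul_left h2 hn0
  -- number of configurations with prescribed pair
  set W : ℝ → ℝ → ℝ → ℝ → ℝ := fun a v u b =>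
    (if a + v = u + b then (1 : ℝ) else 0) * ∑ x ∈ A, ∑ y ∈ A, e x b * e x y * e a y with hW
  have hW0 : ∀ a v u b, 0 ≤ W a v u b := by
    intro a v u b
    refine mul_nonneg (by split_ifs <;> norm_num) (Finset.sum_nonneg fun x _ =>
      Finset.sum_nonneg fun y _ => mul_nonneg (mul_nonneg (e0 _ _) (e0 _ _)) (e0 _ _))
  have hlow : En * (β * n ^ 2) ≤ ∑ p ∈ F, ∑ q ∈ F, W p.1 p.2 q.1 q.2 := by
    rw [hEn, Finset.sum_mul]
    refine Finset.sum_le_sum fun p hp => ?_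
    rw [Finset.sum_mul]
    refine Finset.sum_le_sum fun q hq => ?_
    exact mul_le_mul_of_nonneg_left (hFp p hp q hq) (by split_ifs <;> norm_num)
  have hFA : F ⊆ A ×ˢ A := fun p hp => Finset.mem_product.2 (hE p (hFE hp))
  have hup : ∑ p ∈ F, ∑ q ∈ F, W p.1 p.2 q.1 q.2 ≤
      ∑ p ∈ A ×ˢ A, ∑ q ∈ A ×ˢ A, W p.1 p.2 q.1 q.2 := by
    refine le_trans (Finset.sum_le_sum fun p _ =>
      Finset.sum_le_sum_of_subset_of_nonneg hFA fun _ _ _ => hW0 _ _ _ _) ?_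
    exact Finset.sum_le_sum_of_subset_of_nonneg hFA fun _ _ _ =>
      Finset.sum_nonneg fun _ _ => hW0 _ _ _ _
  have hre : ∑ p ∈ A ×ˢ A, ∑ q ∈ A ×ˢ A, W p.1 p.2 q.1 q.2 =
      ∑ z ∈ A ×ˢ A, ∑ w ∈ A ×ˢ A, W w.1 z.2 z.1 w.2 := by
    simp only [Finset.sum_product]
    -- Σ a v u b → Σ u v a b
    calc ∑ a ∈ A, ∑ v ∈ A, ∑ u ∈ A, ∑ b ∈ A, W a v u b
        = ∑ a ∈ A, ∑ u ∈ A, ∑ v ∈ A, ∑ b ∈ A, W a v u b :=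
          Finset.sum_congr rfl fun a _ => Finset.sum_comm
      _ = ∑ u ∈ A, ∑ a ∈ A, ∑ v ∈ A, ∑ b ∈ A, W a v u b := Finset.sum_comm
      _ = ∑ u ∈ A, ∑ v ∈ A, ∑ a ∈ A, ∑ b ∈ A, W a v u b :=
          Finset.sum_congr rfl fun a _ => Finset.sum_comm
  have hAA : (A ×ˢ A).Nonempty := by
    have := Finset.card_pos.1 hA; exact this.product this
  obtain ⟨z, -, hz⟩ : ∃ z ∈ A ×ˢ A, g * n ^ 3 ≤ ∑ w ∈ A ×ˢ A, W w.1 z.2 z.1 w.2 := by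
    apply Finset.exists_le_of_sum_le hAA
    rw [← hre, Finset.sum_const, nsmul_eq_mul, Finset.card_product]
    push_cast
    rw [← hn]
    refine le_trans ?_ (hlow.trans hup)
    rw [hg]
    have h1 : α ^ 2 * n ^ 3 / K ≤ En := by rw [div_le_iff₀ hK]; linarith
    calc n * n * (α ^ 2 * β / K * n ^ 3) = (α ^ 2 * n ^ 3 / K) * (β * n ^ 2) := by ring
      _ ≤ _ := by gcongr
  -- representations
  set T : ℝ × ℝ → Finset (ℝ × ℝ) := fun p => (A ×ˢ A).filter fun w =>
    w.1 + z.2 = z.1 + w.2 ∧ (p.1, w.2) ∈ E ∧ (w.1, p.2) ∈ E with hT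
  have hTsum : ∑ w ∈ A ×ˢ A, W w.1 z.2 z.1 w.2 = ∑ p ∈ E, ((T p).card : ℝ) := by
    have hEA : (A ×ˢ A).filter (fun p => p ∈ E) = E := by
      ext p
      simp only [Finset.mem_filter, Finset.mem_product]
      exact ⟨fun h => h.2, fun h => ⟨hE p h, h⟩⟩
    have h1 : ∑ p ∈ E, ((T p).card : ℝ) = ∑ p ∈ A ×ˢ A, if p ∈ E then ((T p).card : ℝ) else 0 := by
      rw [← Finset.sum_filter, hEA]
    have h2 : ∀ w : ℝ × ℝ, W w.1 z.2 z.1 w.2 = ∑ p ∈ A ×ˢ A,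
        (if w.1 + z.2 = z.1 + w.2 then (1 : ℝ) else 0) * (e p.1 w.2 * e p.1 p.2 * e w.1 p.2) := by
      intro w
      rw [← Finset.mul_sum, Finset.sum_product]
    rw [h1, Finset.sum_congr rfl fun w _ => h2 w, Finset.sum_comm]
    refine Finset.sum_congr rfl fun p _ => ?_
    have h3 : ((T p).card : ℝ) = ∑ w ∈ A ×ˢ A,
        if w.1 + z.2 = z.1 + w.2 ∧ (p.1, w.2) ∈ E ∧ (w.1, p.2) ∈ E then (1 : ℝ) else 0 := by
      rw [← Finset.sum_filter]; simp [hT]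
    rw [h3]
    split_ifs with hp
    · refine Finset.sum_congr rfl fun w _ => ?_
      have : e p.1 p.2 = 1 := eInd_of_mem hp
      rw [this]
      simp only [he, eInd]
      by_cases a1 : w.1 + z.2 = z.1 + w.2 <;> by_cases a2 : (p.1, w.2) ∈ E <;>
        by_cases a3 : (w.1, p.2) ∈ E <;> simp [a1, a2, a3]
    · refine Finset.sum_eq_zero fun w _ => ?_
      have : e p.1 p.2 = 0 := by simp [he, eInd, hp]
      rw [this]; ring
  rw [hTsum] at hz
  have hTn : ∀ p, ((T p).card : ℝ) ≤ n := by
    intro p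
    rw [hn]
    have : (T p).card ≤ A.card := by
      refine Finset.card_le_card_of_injOn Prod.fst ?_ ?_
      · intro w hw
        exact (Finset.mem_product.1 (Finset.mem_filter.1 hw).1).1
      · intro w hw w' hw' h
        have i1 := (Finset.mem_filter.1 hw).2.1
        have i2 := (Finset.mem_filter.1 hw').2.1
        refine Prod.ext h ?_
        rw [h] at i1
        linarith
    exact_mod_cast this
  have hEn' : (E.card : ℝ) ≤ n ^ 2 := by
    have hEA : E ⊆ A ×ˢ A := fun p hp => Finset.mem_product.2 (hE p hp)
    have := Finset.card_le_card hEA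
    rw [Finset.card_product] at this
    rw [hn, sq]; exact_mod_cast this
  set E₁ := E.filter fun p => g * n / 2 ≤ ((T p).card : ℝ) with hE₁
  refine ⟨E₁, Finset.filter_subset _ _, ?_, ?_⟩
  · have h1 : ∑ p ∈ E, ((T p).card : ℝ) ≤
        ∑ p ∈ E, (g * n / 2 + if g * n / 2 ≤ ((T p).card : ℝ) then n else 0) := by
      refine Finset.sum_le_sum fun p _ => ?_
      split_ifs with h
      · have := hTn p
        have : 0 < g * n := by positivity
        linarith
      · push Not at h; linarith
    rw [Finset.sum_add_distrib, ← Finset.sum_filter, Finset.sum_const, Finset.sum_const,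
      nsmul_eq_mul, nsmul_eq_mul, ← hE₁] at h1
    have h2 : (E.card : ℝ) * (g * n / 2) ≤ n ^ 2 * (g * n / 2) := by gcongr
    have h3 : n * (g / 2 * n ^ 2) ≤ n * (E₁.card : ℝ) := by nlinarith
    exact le_of_mul_le_mul_left h3 hn0
  · set S := E.image (fun p => p.1 + p.2) with hSdef
    set Df := E₁.image (fun p => p.1 - p.2) with hDf
    set R : ℝ → Finset (ℝ × ℝ) := fun t => (S ×ˢ S).filter fun s =>
      s.1 - s.2 + (z.1 - z.2) = t with hR
    have hRl : ∀ t ∈ Df, g * n / 2 ≤ ((R t).card : ℝ) := by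
      intro t ht
      obtain ⟨p, hp, rfl⟩ := Finset.mem_image.1 ht
      refine (Finset.mem_filter.1 hp).2.trans ?_
      have : (T p).card ≤ (R (p.1 - p.2)).card := by
        refine Finset.card_le_card_of_injOn (fun w => (p.1 + w.2, w.1 + p.2)) ?_ ?_
        · intro w hw
          obtain ⟨-, i1, i2, i3⟩ := Finset.mem_filter.1 hw
          refine Finset.mem_filter.2 ⟨Finset.mem_product.2
            ⟨Finset.mem_image.2 ⟨_, i2, rfl⟩, Finset.mem_image.2 ⟨_, i3, rfl⟩⟩, ?_⟩
          simp only
          linarith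
        · intro w _ w' _ h
          simp only [Prod.mk.injEq, add_right_inj, add_left_inj] at h
          exact Prod.ext h.2 h.1
      exact_mod_cast this
    have hRs : ∑ t ∈ Df, (R t).card ≤ (S ×ˢ S).card := by
      rw [← Finset.card_biUnion]
      · refine Finset.card_le_card ?_
        intro s hs
        obtain ⟨t, -, hs⟩ := Finset.mem_biUnion.1 hs
        exact (Finset.mem_filter.1 hs).1
      · intro t _ t' _ htt
        refine Finset.disjoint_left.2 fun s h1 h2 => htt ?_
        rw [← (Finset.mem_filter.1 h1).2, ← (Finset.mem_filter.1 h2).2]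
    have h1 : (Df.card : ℝ) * (g * n / 2) ≤ ∑ t ∈ Df, ((R t).card : ℝ) := by
      simpa [nsmul_eq_mul] using Finset.card_nsmul_le_sum Df _ _ hRl
    have h2 : ∑ t ∈ Df, ((R t).card : ℝ) ≤ (S.card : ℝ) * S.card := by
      rw [Finset.card_product] at hRs
      exact_mod_cast hRs
    have h3 : (S.card : ℝ) * S.card ≤ (K * n) * (K * n) := by gcongr
    have h4 : (Df.card : ℝ) * (g * n / 2) ≤ (2 * K ^ 2 / g * n) * (g * n / 2) := by
      refine (h1.trans (h2.trans h3)).trans (le_of_eq ?_)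
      field_simp
    exact le_of_mul_le_mul_right h4 (by positivity)


/-- For all `ε > 0`, `c > 0`, `K > 0` there is a constant `D = D(ε, c, K)`
such that for every sufficiently large finite set `A` of reals: if `G` is a graph on vertex
set `A` (symmetric edge set `E ⊆ A × A`) with `|A +_G A| ≤ K·|A|` and `|E(G)| ≥ c·|A|²`,
then there is a subgraph `G′ ⊆ G` (edge set `E′ ⊆ E`) with `|E(G′)| ≥ (1 − ε)·|E(G)|` and
`|A −_{G′} A| ≤ D·|A|`. -/
theorem stmt_5 (ε c K : ℝ) (hε : 0 < ε) (hc : 0 < c) (hK : 0 < K) :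
    ∃ D : ℝ, ∃ n₀ : ℕ, ∀ (A : Finset ℝ) (E : Finset (ℝ × ℝ)),
      n₀ ≤ A.card →
      (∀ p ∈ E, p.1 ∈ A ∧ p.2 ∈ A) →
      (∀ p ∈ E, (p.2, p.1) ∈ E) →
      ((E.image (fun p => p.1 + p.2)).card : ℝ) ≤ K * (A.card : ℝ) →
      c * (A.card : ℝ) ^ 2 ≤ (E.card : ℝ) →
      ∃ E' : Finset (ℝ × ℝ), E' ⊆ E ∧
        (1 - ε) * (E.card : ℝ) ≤ (E'.card : ℝ) ∧
        ((E'.image (fun p => p.1 - p.2)).card : ℝ) ≤ D * (A.card : ℝ) := by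
  classical
  obtain ⟨γ, C, hγ, hC, hcore⟩ := core_lemma (ε * c) K (by positivity) hK
  obtain ⟨k, hk⟩ := exists_nat_gt (1 / γ)
  refine ⟨k * C, 1, ?_⟩
  intro A E hA hE _ hS hcard
  have hA0 : 0 < A.card := hA
  have hn0 : (0 : ℝ) < A.card := by exact_mod_cast hA0
  have hiter : ∀ m : ℕ, ∃ E' ⊆ E, ((E'.image (fun p => p.1 - p.2)).card : ℝ) ≤ m * C * A.card ∧
      (((E \ E').card : ℝ) < ε * c * (A.card : ℝ) ^ 2 ∨ m * γ * (A.card : ℝ) ^ 2 ≤ E'.card) := by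
    intro m
    induction m with
    | zero => exact ⟨∅, by simp, by simp, Or.inr (by simp)⟩
    | succ m ih =>
      obtain ⟨E', hE', hd, hor⟩ := ih
      by_cases h : ((E \ E').card : ℝ) < ε * c * (A.card : ℝ) ^ 2
      · refine ⟨E', hE', hd.trans ?_, Or.inl h⟩
        push_cast
        gcongr
        linarith
      · have hor := hor.resolve_left h
        push Not at h
        have hS' : (((E \ E').image (fun p => p.1 + p.2)).card : ℝ) ≤ K * A.card := by
          refine le_trans ?_ hS
          exact_mod_cast Finset.card_le_card (Finset.image_subset_image Finset.sdiff_subset)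
        obtain ⟨E₁, h1, h2, h3⟩ := hcore A (E \ E') hA0
          (fun p hp => hE p (Finset.sdiff_subset hp)) hS' h
        refine ⟨E' ∪ E₁, Finset.union_subset hE' (h1.trans Finset.sdiff_subset), ?_, Or.inr ?_⟩
        · rw [Finset.image_union]
          have := Finset.card_union_le (E'.image (fun p => p.1 - p.2))
            (E₁.image (fun p => p.1 - p.2))
          have h4 : (((E'.image (fun p => p.1 - p.2)) ∪
            (E₁.image (fun p => p.1 - p.2))).card : ℝ) ≤ (E'.image (fun p => p.1 - p.2)).card +
            (E₁.image (fun p => p.1 - p.2)).card := by exact_mod_cast this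
          push_cast
          linarith
        · rw [Finset.card_union_of_disjoint]
          · push_cast
            linarith
          · exact Finset.disjoint_of_subset_right h1 Finset.disjoint_sdiff
  obtain ⟨E', hE', hd, hor⟩ := hiter k
  refine ⟨E', hE', ?_, hd⟩
  rcases hor with h | h
  · have h1 : ((E \ E').card : ℝ) = E.card - E'.card := by
      rw [Finset.card_sdiff_of_subset hE', Nat.cast_sub (Finset.card_le_card hE')]
    have h2 : ε * (c * (A.card : ℝ) ^ 2) ≤ ε * E.card := by gcongr
    rw [h1] at h
    linarith
  · exfalso
    have hEA : E' ⊆ A ×ˢ A := fun p hp => Finset.mem_product.2 (hE p (hE' hp))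
    have h1 := Finset.card_le_card hEA
    rw [Finset.card_product] at h1
    have h2 : (E'.card : ℝ) ≤ A.card * A.card := by exact_mod_cast h1
    rw [div_lt_iff₀ hγ] at hk
    have h3 : 1 * (A.card : ℝ) ^ 2 < k * γ * (A.card : ℝ) ^ 2 := by gcongr
    linarith
end
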